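/- arXiv:1102.3447 — 4 statements merged into one kernel-verified Lean document; each statement's English description precedes it below -/
import Mathlib

section
/- Let k be a field of characteristic p, G a finite group, and H a subgroup of G whose index [G:H] is not divisible by p. A kG-module M is algebraic if and only if its restriction to H is an algebraic kH-module. -/
open CategoryTheory CategoryTheory.MonoidalCategory

namespace AlgebraicModule

variable {k G : Type} [Field k] [Monoid G]

/-- `N` is a direct summand of `M`, i.e. a retract of `M`. -/
def IsSummand (N M : FDRep k G) : Prop :=
  ∃ (i : N ⟶ M) (r : M ⟶ N), i ≫ r = 𝟙 N

/-- `M` is an indecomposable module: it is nonzero and is not the direct sum of two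
nonzero submodules (equivalently, its only idempotent endomorphisms are `0` and `1`). -/
def Indecomposable (M : FDRep k G) : Prop :=
  ¬ Limits.IsZero M ∧ ∀ e : M ⟶ M, e ≫ e = e → e = 0 ∨ e = 𝟙 M

/-- `tensorPow M n` is the tensor power `M^{⊗ (n + 1)}`, with diagonal `G`-action. -/
noncomputable def tensorPow (M : FDRep k G) : ℕ → FDRep k G
  | 0 => M
  | n + 1 => tensorPow M n ⊗ M

/-- `M` is algebraic: only finitely many isomorphism classes of indecomposable modules
occur as direct summands of the tensor powers `M^{⊗ n}` for `n ≥ 1`. -/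
noncomputable def IsAlgebraic (M : FDRep k G) : Prop :=
  ∃ L : List (FDRep k G), ∀ N : FDRep k G, Indecomposable N →
    (∃ n : ℕ, IsSummand N (tensorPow M n)) → ∃ N' ∈ L, Nonempty (N ≅ N')

end AlgebraicModule

open AlgebraicModule

/-- The restriction of a `kG`-module to a subgroup `H` of `G`. -/
noncomputable def resModule {k G : Type} [Field k] [Group G] (H : Subgroup G)
    (M : FDRep k G) : FDRep k H :=
  (Action.res (FGModuleCat k) H.subtype).obj M


section FinAlg

open Polynomial in
theorem isUnit_or_isNilpotent_of_idem {k A : Type*} [Field k] [Ring A] [Algebra k A]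
    [FiniteDimensional k A] (h : ∀ e : A, e * e = e → e = 0 ∨ e = 1) (f : A) :
    IsUnit f ∨ IsNilpotent f := by
  have hint : IsIntegral k f := IsIntegral.of_finite k f
  have hne : minpoly k f ≠ 0 := minpoly.ne_zero hint
  obtain ⟨q, hq, hnd⟩ := Polynomial.exists_eq_pow_rootMultiplicity_mul_and_not_dvd _ hne (0 : k)
  set m := (minpoly k f).rootMultiplicity 0 with hm
  rw [C_0, sub_zero] at hq hnd
  have hcop : IsCoprime ((X : k[X]) ^ (m + 1)) q :=
    ((Polynomial.irreducible_X.coprime_iff_not_dvd).2 hnd).pow_left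
  obtain ⟨u, v, huv⟩ := hcop
  have hz : aeval f ((X : k[X]) ^ (m + 1) * q) = 0 := by
    rw [pow_succ', mul_assoc, ← hq, map_mul, minpoly.aeval, mul_zero]
  have key := h (aeval f (u * X ^ (m + 1))) (by
    rw [← map_mul]
    have : u * (X : k[X]) ^ (m + 1) * (u * X ^ (m + 1))
        = u * X ^ (m + 1) - (X ^ (m + 1) * q) * (u * v) := by
      linear_combination (u * X ^ (m + 1)) * huv
    rw [this, map_sub, map_mul _ (X ^ (m + 1) * q), hz, zero_mul, sub_zero])
  rcases key with h0 | h1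
  · right
    refine ⟨m + 1, ?_⟩
    have : (X : k[X]) ^ (m + 1) = (u * X ^ (m + 1)) * X ^ (m + 1) + (X ^ (m + 1) * q) * v := by
      linear_combination (- X ^ (m + 1)) * huv
    have h2 := congrArg (aeval f) this
    rw [map_add, map_mul, map_mul _ (X ^ (m + 1) * q), hz, h0] at h2
    simpa using h2
  · left
    have e1 : aeval f (u * X ^ m) * f = 1 := by
      rw [← h1]
      simp [pow_succ, mul_assoc]
    have e2 : f * aeval f (u * X ^ m) = 1 := by
      have h5 : aeval f ((X : k[X]) * (u * X ^ m)) = aeval f ((u * X ^ m) * (X : k[X])) := by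
        rw [mul_comm]
      rw [map_mul (aeval f) X, map_mul (aeval f) _ X, aeval_X] at h5
      rw [h5, e1]
    exact ⟨⟨f, _, e2, e1⟩, rfl⟩

theorem exists_isUnit_of_sum {k A : Type*} [Field k] [Ring A] [Algebra k A] [Nontrivial A]
    [FiniteDimensional k A] (h : ∀ e : A, e * e = e → e = 0 ∨ e = 1) {ι : Type*} (s : Finset ι)
    (f : ι → A) (hs : IsUnit (∑ j ∈ s, f j)) : ∃ j ∈ s, IsUnit (f j) := by
  classical
  induction s using Finset.induction_on with
  | empty => simp at hs
  | insert a s ha ih =>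
    rw [Finset.sum_insert ha] at hs
    obtain ⟨u, hu⟩ := hs
    have hsum : (↑u⁻¹ : A) * f a + (↑u⁻¹ : A) * ∑ j ∈ s, f j = 1 := by
      rw [← mul_add, ← hu, Units.inv_mul]
    rcases isUnit_or_isNilpotent_of_idem (k := k) h ((↑u⁻¹ : A) * f a) with h1 | h1
    · exact ⟨a, by simp, by simpa using h1⟩
    · have h2 : IsUnit ((↑u⁻¹ : A) * ∑ j ∈ s, f j) := by
        rw [← eq_sub_iff_add_eq'] at hsum
        rw [hsum]; exact h1.isUnit_one_sub
      obtain ⟨j, hj, hu'⟩ := ih (by simpa using h2)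
      exact ⟨j, by simp [hj], hu'⟩

end FinAlg

namespace AlgebraicModule

section KS
variable {k G : Type} [Field k] [Monoid G]

theorem IsSummand.trans {A B C : FDRep k G} (h : IsSummand A B) (h' : IsSummand B C) :
    IsSummand A C := by
  obtain ⟨i, r, h⟩ := h
  obtain ⟨i', r', h'⟩ := h'
  exact ⟨i ≫ i', r' ≫ r, by simp [reassoc_of% h', h]⟩

theorem IsSummand.of_iso {A B : FDRep k G} (e : A ≅ B) : IsSummand A B :=
  ⟨e.hom, e.inv, by simp⟩

theorem exists_isSummand_of_sum {N : FDRep k G} (hN : Indecomposable N) {ι : Type} [Fintype ι]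
    (A : ι → FDRep k G) (a : ∀ j, N ⟶ A j) (b : ∀ j, A j ⟶ N)
    (h : ∑ j, a j ≫ b j = 𝟙 N) : ∃ j, IsSummand N (A j) := by
  have : Nontrivial (End N) := ⟨⟨(0 : N ⟶ N), 𝟙 N, fun h0 => hN.1
    ((Limits.IsZero.iff_id_eq_zero N).2 h0.symm)⟩⟩
  have : FiniteDimensional k (End N) := inferInstanceAs (FiniteDimensional k (N ⟶ N))
  obtain ⟨j, -, hj⟩ := exists_isUnit_of_sum (k := k) (A := End N) (fun e he => hN.2 e he)
    Finset.univ (fun j => (a j ≫ b j : N ⟶ N)) (by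
      have : (∑ j, (a j ≫ b j : N ⟶ N) : End N) = 1 := h
      rw [this]; exact isUnit_one)
  obtain ⟨u, hu⟩ := hj
  refine ⟨j, a j, b j ≫ (↑u⁻¹ : End N), ?_⟩
  have := u.inv_mul
  rw [hu] at this
  simpa using this

theorem iso_of_isSummand {N X : FDRep k G} (hN : Indecomposable N) (hX : Indecomposable X)
    (h : IsSummand N X) : Nonempty (N ≅ X) := by
  obtain ⟨i, r, h⟩ := h
  rcases hX.2 (r ≫ i) (by simp [reassoc_of% h]) with h0 | h1
  · exfalso
    apply hN.1
    rw [Limits.IsZero.iff_id_eq_zero]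
    calc 𝟙 N = i ≫ (r ≫ i) ≫ r := by simp [h]
      _ = 0 := by rw [h0]; simp
  · exact ⟨⟨i, r, h, h1⟩⟩

/-- underlying linear map -/
def lin {X Y : FDRep k G} (f : X ⟶ Y) : X →ₗ[k] Y := f.hom.hom.hom

theorem lin_ext {X Y : FDRep k G} {f g : X ⟶ Y} (h : ∀ x, lin f x = lin g x) : f = g := by
  apply Action.Hom.ext
  apply InducedCategory.hom_ext
  apply ModuleCat.hom_ext
  exact LinearMap.ext h

theorem lin_comp {X Y Z : FDRep k G} (f : X ⟶ Y) (g : Y ⟶ Z) (x : X) :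
    lin (f ≫ g) x = lin g (lin f x) := rfl

theorem lin_id {X : FDRep k G} (x : X) : lin (𝟙 X) x = x := rfl

theorem lin_add {X Y : FDRep k G} (f g : X ⟶ Y) (x : X) :
    lin (f + g) x = lin f x + lin g x := rfl

theorem lin_zero {X Y : FDRep k G} (x : X) :
    lin (0 : X ⟶ Y) x = 0 := rfl

theorem lin_smul {X Y : FDRep k G} (c : k) (f : X ⟶ Y) (x : X) :
    lin (c • f) x = c • lin f x := rfl

theorem lin_sum {X Y : FDRep k G} {ι : Type} (s : Finset ι) (f : ι → (X ⟶ Y)) (x : X) :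
    lin (∑ j ∈ s, f j) x = ∑ j ∈ s, lin (f j) x := by
  classical
  induction s using Finset.induction_on with
  | empty => simp [lin_zero]
  | insert a s ha ih => rw [Finset.sum_insert ha, Finset.sum_insert ha, lin_add, ih]

theorem lin_comm {X Y : FDRep k G} (f : X ⟶ Y) (g : G) (x : X) :
    lin f (X.ρ g x) = Y.ρ g (lin f x) := by
  have := f.comm g
  exact congrArg (fun t => t.hom.hom x) this

/-- morphism from an equivariant linear map -/
def mkHom {X Y : FDRep k G} (f : X →ₗ[k] Y) (h : ∀ g x, f (X.ρ g x) = Y.ρ g (f x)) : X ⟶ Y :=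
  ⟨InducedCategory.homMk (ModuleCat.ofHom f), fun g => by
    apply InducedCategory.hom_ext
    apply ModuleCat.hom_ext
    exact LinearMap.ext (h g)⟩

theorem lin_mkHom {X Y : FDRep k G} (f : X →ₗ[k] Y) (h) (x : X) : lin (mkHom f h) x = f x := rfl

theorem finrank_lt {A X : FDRep k G} (i : A ⟶ X) (r : X ⟶ A) (h : i ≫ r = 𝟙 A)
    (h' : r ≫ i ≠ 𝟙 X) : Module.finrank k A < Module.finrank k X := by
  have hl : ∀ x, lin r (lin i x) = x := fun x => by rw [← lin_comp, h, lin_id]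
  have hinj : Function.Injective (lin i) := Function.LeftInverse.injective hl
  refine lt_of_le_of_ne (LinearMap.finrank_le_finrank_of_injective hinj) fun he => h' ?_
  have hs : Function.Surjective (lin i) :=
    (LinearMap.injective_iff_surjective_of_finrank_eq_finrank he).1 hinj
  apply lin_ext
  intro x
  obtain ⟨y, rfl⟩ := hs x
  rw [lin_comp, hl, lin_id]

theorem split_idem {X : FDRep k G} (e : X ⟶ X) (he : e ≫ e = e) :
    ∃ (A : FDRep k G) (i : A ⟶ X) (r : X ⟶ A), i ≫ r = 𝟙 A ∧ r ≫ i = e := by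
  have : IsIdempotentComplete (FDRep k G) := by
    rw [Idempotents.isIdempotentComplete_iff_hasEqualizer_of_id_and_idempotent]
    intros; infer_instance
  obtain ⟨A, i, r, h1, h2⟩ := IsIdempotentComplete.idempotents_split X e he
  exact ⟨A, i, r, h1, h2⟩

theorem exists_decomp (X : FDRep k G) : ∃ (ι : Type) (_ : Fintype ι) (A : ι → FDRep k G)
    (i : ∀ j, A j ⟶ X) (r : ∀ j, X ⟶ A j), (∀ j, Indecomposable (A j)) ∧
    (∀ j, i j ≫ r j = 𝟙 (A j)) ∧ ∑ j, r j ≫ i j = 𝟙 X := by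
  induction hn : Module.finrank k X using Nat.strong_induction_on generalizing X with
  | _ n ih =>
  subst hn
  by_cases hz : Limits.IsZero X
  · exact ⟨Empty, inferInstance, fun j => j.elim, fun j => j.elim, fun j => j.elim,
      fun j => j.elim, fun j => j.elim, hz.eq_of_src _ _⟩
  by_cases hX : Indecomposable X
  · exact ⟨Unit, inferInstance, fun _ => X, fun _ => 𝟙 X, fun _ => 𝟙 X, fun _ => hX,
      fun _ => by simp, by simp⟩
  have : ∃ e : X ⟶ X, e ≫ e = e ∧ e ≠ 0 ∧ e ≠ 𝟙 X := by
    by_contra! hcon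
    exact hX ⟨hz, fun e he => or_iff_not_imp_left.2 (hcon e he)⟩
  obtain ⟨e, he, he0, he1⟩ := this
  obtain ⟨A, i, r, hir, hri⟩ := split_idem e he
  obtain ⟨B, i', r', hir', hri'⟩ := split_idem (𝟙 X - e) (by simp [he])
  obtain ⟨ι, _, A1, i1, r1, hA, hA1, hA2⟩ := ih _ (finrank_lt i r hir (by rwa [hri])) A rfl
  obtain ⟨ι', _, B1, i2, r2, hB, hB1, hB2⟩ := ih _ (finrank_lt i' r' hir' (by
    rw [hri']; intro h; exact he0 (by simpa using h))) B rfl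
  refine ⟨ι ⊕ ι', inferInstance, Sum.elim A1 B1,
    fun j => match j with | .inl j => i1 j ≫ i | .inr j => i2 j ≫ i',
    fun j => match j with | .inl j => r ≫ r1 j | .inr j => r' ≫ r2 j, ?_, ?_, ?_⟩
  · rintro (j | j)
    · exact hA j
    · exact hB j
  · rintro (j | j)
    · simpa [reassoc_of% hir] using hA1 j
    · simpa [reassoc_of% hir'] using hB1 j
  · rw [Fintype.sum_sum_type]
    have e1 : ∑ j, (r ≫ r1 j) ≫ (i1 j ≫ i) = e := by
      calc _ = r ≫ (∑ j, r1 j ≫ i1 j) ≫ i := by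
            simp [Preadditive.comp_sum, Preadditive.sum_comp]
        _ = e := by rw [hA2]; simpa using hri
    have e2 : ∑ j, (r' ≫ r2 j) ≫ (i2 j ≫ i') = 𝟙 X - e := by
      calc _ = r' ≫ (∑ j, r2 j ≫ i2 j) ≫ i' := by
            simp [Preadditive.comp_sum, Preadditive.sum_comp]
        _ = _ := by rw [hB2]; simpa using hri'
    refine (congrArg₂ (· + ·) e1 e2).trans (by simp)

theorem exists_list (L : List (FDRep k G)) : ∃ L' : List (FDRep k G), ∀ N, Indecomposable N →
    (∃ X ∈ L, IsSummand N X) → ∃ N' ∈ L', Nonempty (N ≅ N') := by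
  induction L with
  | nil => exact ⟨[], by simp⟩
  | cons X L ih =>
    obtain ⟨L', hL'⟩ := ih
    obtain ⟨ι, _, A, i, r, hA, h1, h2⟩ := exists_decomp X
    refine ⟨(Finset.univ.toList.map A) ++ L', fun N hN hs => ?_⟩
    obtain ⟨Y, hY, hs⟩ := hs
    rcases List.mem_cons.1 hY with rfl | hY
    · obtain ⟨i0, r0, h0⟩ := hs
      obtain ⟨j, hj⟩ := exists_isSummand_of_sum hN A (fun j => i0 ≫ r j) (fun j => i j ≫ r0) (by
        calc _ = i0 ≫ (∑ j, r j ≫ i j) ≫ r0 := by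
              simp [Preadditive.comp_sum, Preadditive.sum_comp]
          _ = 𝟙 N := by rw [h2]; simpa using h0)
      exact ⟨A j, by simp, iso_of_isSummand hN (hA j) hj⟩
    · obtain ⟨N', hN', e⟩ := hL' N hN ⟨Y, hY, hs⟩
      exact ⟨N', by simp [hN'], e⟩

end KS

section Res
variable {k G : Type} [Field k] [Group G] (H : Subgroup G)

/-- restriction of morphisms -/
def resHom {X Y : FDRep k G} (f : X ⟶ Y) : resModule H X ⟶ resModule H Y :=
  (Action.res (FGModuleCat k) H.subtype).map f

theorem lin_resHom {X Y : FDRep k G} (f : X ⟶ Y) (x : X) : lin (resHom H f) x = lin f x := rfl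

theorem resModule_rho (X : FDRep k G) (h : H) (x : X) :
  (resModule H X).ρ h x = X.ρ (h : G) x := rfl

theorem resHom_comp {X Y Z : FDRep k G} (f : X ⟶ Y) (g : Y ⟶ Z) :
    resHom H (f ≫ g) = resHom H f ≫ resHom H g := rfl

theorem resHom_id (X : FDRep k G) : resHom H (𝟙 X) = 𝟙 (resModule H X) := rfl

theorem resHom_sum {X Y : FDRep k G} {ι : Type} (s : Finset ι) (f : ι → (X ⟶ Y)) :
    resHom H (∑ j ∈ s, f j) = ∑ j ∈ s, resHom H (f j) := by
  apply lin_ext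
  intro x
  refine (lin_sum s f x).trans ?_
  exact (lin_sum s (fun j => resHom H (f j)) x).symm

theorem isSummand_res {X Y : FDRep k G} (h : IsSummand X Y) :
    IsSummand (resModule H X) (resModule H Y) := by
  obtain ⟨i, r, h⟩ := h
  exact ⟨resHom H i, resHom H r, by rw [← resHom_comp, h, resHom_id]⟩

theorem res_tensor (X Y : FDRep k G) :
    resModule H (X ⊗ Y) = resModule H X ⊗ resModule H Y := rfl

theorem res_tensorPow (M : FDRep k G) (n : ℕ) :
    resModule H (tensorPow M n) = tensorPow (resModule H M) n := by
  induction n with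
  | zero => rfl
  | succ n ih => simp only [tensorPow, res_tensor, ih]

/-- coinduced module -/
noncomputable def coindModule [Finite G] (A : FDRep k H) : FDRep k G :=
  FDRep.of (Representation.coind H.subtype A.ρ)

/-- underlying linear map of a map out of a restriction -/
noncomputable def linOut {N : FDRep k G} {A : FDRep k H} (r : resModule H N ⟶ A) : N →ₗ[k] A := lin r

/-- underlying linear map of a map into a restriction -/
noncomputable def linIn {N : FDRep k G} {A : FDRep k H} (i : A ⟶ resModule H N) : A →ₗ[k] N := lin i

/-- underlying linear map of an endomorphism of a restriction -/
noncomputable def linEnd {N : FDRep k G} (f : resModule H N ⟶ resModule H N) : N →ₗ[k] N :=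
  lin (X := resModule H N) (Y := resModule H N) f

theorem linOut_comm {N : FDRep k G} {A : FDRep k H} (r : resModule H N ⟶ A) (h : H) (x : N) :
    linOut H r (N.ρ (h : G) x) = A.ρ h (linOut H r x) := lin_comm r h x

theorem linIn_comm {N : FDRep k G} {A : FDRep k H} (i : A ⟶ resModule H N) (h : H) (x : A) :
    linIn H i (A.ρ h x) = N.ρ (h : G) (linIn H i x) := lin_comm i h x

theorem linEnd_sum {N : FDRep k G} {ι : Type} (s : Finset ι)
    (f : ι → (resModule H N ⟶ resModule H N)) (x : N) :
    linEnd H (∑ j ∈ s, f j) x = ∑ j ∈ s, linEnd H (f j) x := lin_sum s f x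

theorem linEnd_id {N : FDRep k G} (x : N) : linEnd H (𝟙 (resModule H N)) x = x := rfl

theorem exists_trace [Finite G] [Fintype (G ⧸ H)] (N : FDRep k G) (A : FDRep k H)
    (r : resModule H N ⟶ A) (i : A ⟶ resModule H N) :
    ∃ (a : N ⟶ coindModule H A) (b : coindModule H A ⟶ N), ∀ x : N,
      lin (a ≫ b) x = ∑ q : G ⧸ H, N.ρ q.out (linEnd H (r ≫ i) (N.ρ q.out⁻¹ x)) := by
  let a0 : N →ₗ[k] Representation.coindV H.subtype A.ρ :=
    { toFun := fun x => ⟨fun g => linOut H r (N.ρ g x), fun h g => by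
        change linOut H r (N.ρ ((h : G) * g) x) = A.ρ h (linOut H r (N.ρ g x))
        rw [map_mul, Module.End.mul_apply]
        exact linOut_comm H r h _⟩
      map_add' := fun x y => by ext; simp
      map_smul' := fun c x => by ext; simp }
  let b0 : Representation.coindV H.subtype A.ρ →ₗ[k] N :=
    { toFun := fun f => ∑ q : G ⧸ H, N.ρ q.out (linIn H i (f.1 q.out⁻¹))
      map_add' := fun x y => by simp [Finset.sum_add_distrib]
      map_smul' := fun c x => by simp [Finset.smul_sum] }
  have hb : ∀ (f : Representation.coindV H.subtype A.ρ) (g g' : G),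
      (QuotientGroup.mk g : G ⧸ H) = QuotientGroup.mk g' →
      N.ρ g (linIn H i (f.1 g⁻¹)) = N.ρ g' (linIn H i (f.1 g'⁻¹)) := by
    intro f g g' hg
    rw [QuotientGroup.eq] at hg
    have h1 := f.2 ⟨_, hg⟩ g'⁻¹
    have h2 : H.subtype ⟨_, hg⟩ * g'⁻¹ = g⁻¹ := by simp
    rw [h2] at h1
    rw [h1, linIn_comm, ← Module.End.mul_apply, ← map_mul]
    simp
  refine ⟨mkHom (Y := coindModule H A) a0 ?_, mkHom (X := coindModule H A) b0 ?_, ?_⟩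
  · intro g x
    apply Subtype.ext
    funext g'
    change linOut H r (N.ρ g' (N.ρ g x)) = linOut H r (N.ρ (g' * g) x)
    rw [map_mul, Module.End.mul_apply]
  · intro g (f : Representation.coindV H.subtype A.ρ)
    change ∑ q : G ⧸ H, N.ρ q.out (linIn H i (f.1 (q.out⁻¹ * g))) =
      N.ρ g (∑ q : G ⧸ H, N.ρ q.out (linIn H i (f.1 q.out⁻¹)))
    rw [map_sum]
    refine Fintype.sum_equiv (MulAction.toPerm g⁻¹) _ _ fun q => ?_
    rw [MulAction.toPerm_apply]
    rw [← hb f (g⁻¹ * q.out) (g⁻¹ • q).out (by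
      rw [QuotientGroup.out_eq', ← smul_eq_mul, ← MulAction.Quotient.smul_mk,
        QuotientGroup.out_eq'])]
    rw [← Module.End.mul_apply (N.ρ g), ← map_mul]
    simp
  · intro x
    rfl

end Res

end AlgebraicModule

/-- If `H ≤ G` has index prime to `p`, then a `kG`-module `M` is algebraic if and
only if its restriction to `H` is algebraic. -/
theorem algebraic_iff_restriction_algebraic (p : ℕ) (k : Type) [Field k] (hk : CharP k p)
    (G : Type) [Group G] [Finite G] (H : Subgroup G) (hH : ¬ p ∣ H.index)
    (M : FDRep k G) :
    IsAlgebraic M ↔ IsAlgebraic (resModule H M) := by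
  constructor
  · rintro ⟨L, hL⟩
    obtain ⟨L', hL'⟩ := exists_list (L.map (resModule H))
    refine ⟨L', fun N hN ⟨n, hn⟩ => hL' N hN ?_⟩
    rw [← res_tensorPow] at hn
    obtain ⟨i0, r0, h0⟩ := hn
    obtain ⟨ι, _, A, i, r, hA, h1, h2⟩ := exists_decomp (tensorPow M n)
    obtain ⟨j, hj⟩ := exists_isSummand_of_sum hN (fun j => resModule H (A j))
      (fun j => i0 ≫ resHom H (r j)) (fun j => resHom H (i j) ≫ r0) (by
        calc _ = i0 ≫ (∑ j, resHom H (r j) ≫ resHom H (i j)) ≫ r0 := by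
              simp [Preadditive.comp_sum, Preadditive.sum_comp]
          _ = i0 ≫ resHom H (∑ j, r j ≫ i j) ≫ r0 := by rw [resHom_sum]; rfl
          _ = 𝟙 N := by rw [h2, resHom_id]; simpa using h0)
    obtain ⟨X, hX, ⟨e⟩⟩ := hL (A j) (hA j) ⟨n, i j, r j, h1 j⟩
    exact ⟨resModule H X, List.mem_map_of_mem hX,
      hj.trans (isSummand_res H (IsSummand.of_iso e))⟩
  · rintro ⟨L, hL⟩
    obtain ⟨L', hL'⟩ := exists_list (L.map (coindModule H))
    refine ⟨L', fun N hN ⟨n, hn⟩ => hL' N hN ?_⟩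
    have hn' := isSummand_res H hn
    rw [res_tensorPow] at hn'
    obtain ⟨ι, _, A, i, r, hA, h1, h2⟩ := exists_decomp (resModule H N)
    have hX : ∀ j, ∃ X ∈ L, Nonempty (A j ≅ X) := fun j =>
      hL (A j) (hA j) ⟨n, IsSummand.trans ⟨i j, r j, h1 j⟩ hn'⟩
    choose X hXL e using hX
    have : Fintype (G ⧸ H) := Fintype.ofFinite _
    choose a b hab using fun j =>
      exists_trace H N (X j) (r j ≫ (e j).some.hom) ((e j).some.inv ≫ i j)
    have hc : (H.index : k) ≠ 0 := by rwa [Ne, CharP.cast_eq_zero_iff k p]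
    obtain ⟨j, hj⟩ := exists_isSummand_of_sum hN (fun j => coindModule H (X j))
      a (fun j => (H.index : k)⁻¹ • b j) (by
        apply lin_ext
        intro x
        rw [lin_sum, lin_id]
        simp only [Linear.comp_smul, lin_smul, hab]
        rw [← Finset.smul_sum, Finset.sum_comm]
        have : ∀ q : G ⧸ H, ∑ j, N.ρ q.out (linEnd H ((r j ≫ (e j).some.hom) ≫
            ((e j).some.inv ≫ i j)) (N.ρ q.out⁻¹ x)) = x := by
          intro q
          have h3 : ∑ j, (r j ≫ (e j).some.hom) ≫ ((e j).some.inv ≫ i j) =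
            𝟙 (resModule H N) := by simpa using h2
          rw [← map_sum, ← linEnd_sum, h3, linEnd_id, ← Module.End.mul_apply, ← map_mul]
          simp
        rw [Finset.sum_congr rfl fun q _ => this q]
        rw [Finset.sum_const, Finset.card_univ, ← Nat.card_eq_fintype_card,
          ← Subgroup.index_eq_card, ← Nat.cast_smul_eq_nsmul k, smul_smul,
          inv_mul_cancel₀ hc, one_smul])
    exact ⟨_, List.mem_map_of_mem (hXL j), hj⟩
end

section
/- Let G be a finite group, Q a subgroup of G isomorphic to the Klein four group C_2 × C_2, and k an algebraically closed field of characteristic 2. If M is a kG-module such that the restriction of M to Q has an indecomposable direct summand of odd dimension greater than 1, then M is non-algebraic. -/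
open CategoryTheory CategoryTheory.MonoidalCategory

open AlgebraicModule

namespace V4
section lin
open Polynomial TensorProduct
variable {k : Type} [Field k]
variable {V W : Type} [AddCommGroup V] [Module k V] [AddCommGroup W] [Module k W]

/-- polynomial functionals `φ` with `φ ∘ x = X • φ ∘ y`. -/
def IsF (x y : V →ₗ[k] V) (φ : V →ₗ[k] k[X]) : Prop := ∀ a, φ (x a) = X * φ (y a)

def Bdd (b : ℕ) (x y : V →ₗ[k] V) : Prop :=
  ∀ v, (∀ φ, IsF x y φ → X ^ b ∣ φ v) → ∀ φ, IsF x y φ → φ v = 0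

def Good (m : ℕ) (x y : V →ₗ[k] V) : Prop :=
  ∃ v, x v = 0 ∧ y v = 0 ∧ (∀ φ, IsF x y φ → X ^ m ∣ φ v) ∧ ∃ φ, IsF x y φ ∧ φ v ≠ 0

def CaseA (x y : V →ₗ[k] V) : Prop :=
  ∃ w φ, IsF x y φ ∧ x (x w) = 0 ∧ y (x w) = 0 ∧ x (y w) = 0 ∧ y (y w) = 0 ∧ φ (y w) ≠ 0

theorem Bdd.mono {b c : ℕ} (h : b ≤ c) {x y : V →ₗ[k] V} (hb : Bdd b x y) : Bdd c x y :=
  fun v hv => hb v fun φ hφ => (pow_dvd_pow _ h).trans (hv φ hφ)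

theorem Good.not_bdd {m b : ℕ} (h : b ≤ m) {x y : V →ₗ[k] V} (hg : Good m x y) :
    ¬ Bdd b x y := by
  obtain ⟨v, -, -, h1, φ, hφ, h2⟩ := hg
  exact fun hb => h2 (hb.mono h v h1 φ hφ)

theorem exists_bdd [FiniteDimensional k V] (x y : V →ₗ[k] V) : ∃ b, Bdd b x y := by
  let S : ℕ → Submodule k V := fun b =>
    { carrier := {v | ∀ φ, IsF x y φ → X ^ b ∣ φ v}
      add_mem' := fun {u v} hu hv φ hφ => by
        rw [map_add]; exact dvd_add (hu φ hφ) (hv φ hφ)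
      zero_mem' := fun φ hφ => by simp
      smul_mem' := fun c v hv φ hφ => by
        rw [map_smul, Polynomial.smul_eq_C_mul]; exact (hv φ hφ).mul_left _ }
  have hS : Antitone S := fun b c hbc v hv φ hφ => (pow_dvd_pow _ hbc).trans (hv φ hφ)
  obtain ⟨b, hb⟩ := IsArtinian.monotone_stabilizes (R := k) (M := V) ⟨fun n => OrderDual.toDual (S n), hS⟩
  refine ⟨b, fun v hv φ hφ => ?_⟩
  by_contra hne
  have key : ∀ c, X ^ c ∣ φ v := fun c => by
    rcases le_total b c with h | h
    · have := hb c h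
      have h2 : S b = S c := this
      have h3 : v ∈ S c := h2 ▸ (show v ∈ S b from hv)
      exact h3 φ hφ
    · exact hS h hv φ hφ
  have := Polynomial.natDegree_le_of_dvd (key ((φ v).natDegree + 1)) hne
  simp at this

/-- retract transfer -/
theorem CaseA.retract {x y : V →ₗ[k] V} {x' y' : W →ₗ[k] W} (i : V →ₗ[k] W) (r : W →ₗ[k] V)
    (hir : ∀ a, r (i a) = a) (hx : ∀ a, i (x a) = x' (i a)) (hy : ∀ a, i (y a) = y' (i a))
    (rx : ∀ a, r (x' a) = x (r a)) (ry : ∀ a, r (y' a) = y (r a)) (h : CaseA x y) :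
    CaseA x' y' := by
  obtain ⟨w, φ, hφ, h1, h2, h3, h4, h5⟩ := h
  refine ⟨i w, φ ∘ₗ r, fun a => ?_, ?_, ?_, ?_, ?_, ?_⟩
  · simp [rx, ry, hφ _]
  · rw [← hx, ← hx, h1, map_zero]
  · rw [← hx, ← hy, h2, map_zero]
  · rw [← hy, ← hx, h3, map_zero]
  · rw [← hy, ← hy, h4, map_zero]
  · simpa [← hy, hir] using h5

theorem Good.equiv {m : ℕ} {x y : V →ₗ[k] V} {x' y' : W →ₗ[k] W} (e : V ≃ₗ[k] W)
    (hx : ∀ a, e (x a) = x' (e a)) (hy : ∀ a, e (y a) = y' (e a)) (h : Good m x y) :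
    Good m x' y' := by
  obtain ⟨v, h1, h2, h3, φ, hφ, h4⟩ := h
  refine ⟨e v, by rw [← hx, h1, map_zero], by rw [← hy, h2, map_zero], fun ψ hψ => ?_,
    φ ∘ₗ e.symm.toLinearMap, fun a => ?_, by simpa using h4⟩
  · exact h3 (ψ ∘ₗ e.toLinearMap) (fun a => by simp [hx, hy, hψ _])
  · obtain ⟨b, rfl⟩ := e.surjective a
    simp [← hx, ← hy, hφ _]

theorem Bdd.retract {b : ℕ} {x y : V →ₗ[k] V} {x' y' : W →ₗ[k] W} (i : V →ₗ[k] W) (r : W →ₗ[k] V)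
    (hx : ∀ a, i (x a) = x' (i a)) (hy : ∀ a, i (y a) = y' (i a))
    (rx : ∀ a, r (x' a) = x (r a)) (ry : ∀ a, r (y' a) = y (r a)) (h : Bdd b x y) (v : W)
    (hv : ∀ φ, IsF x' y' φ → X ^ b ∣ φ v) (φ) (hφ : IsF x' y' φ) : φ (i (r v)) = 0 := by
  refine h (r v) (fun ψ hψ => ?_) (φ ∘ₗ i) (fun a => by simp [hx, hy, hφ _])
  exact hv (ψ ∘ₗ r) (fun a => by simp [rx, ry, hψ _])

theorem Good.base {x y : V →ₗ[k] V} (h : CaseA x y) : Good 1 x y := by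
  obtain ⟨w, φ, hφ, h1, h2, h3, h4, h5⟩ := h
  exact ⟨x w, h1, h2, fun ψ hψ => by rw [hψ, pow_one]; exact dvd_mul_right _ _, φ, hφ,
    by rw [hφ]; exact mul_ne_zero X_ne_zero h5⟩

/-- the action of `g - 1` on a tensor product -/
noncomputable def tx (x : V →ₗ[k] V) (x' : W →ₗ[k] W) : V ⊗[k] W →ₗ[k] V ⊗[k] W :=
  TensorProduct.map x LinearMap.id + TensorProduct.map LinearMap.id x' + TensorProduct.map x x'

theorem tx_tmul (x : V →ₗ[k] V) (x' : W →ₗ[k] W) (a : V) (b : W) :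
    tx x x' (a ⊗ₜ b) = x a ⊗ₜ b + a ⊗ₜ x' b + x a ⊗ₜ x' b := by simp [tx]

/-- product functional -/
noncomputable def prodF (y : V →ₗ[k] V) (φ : V →ₗ[k] k[X]) (ψ : W →ₗ[k] k[X]) :
    V ⊗[k] W →ₗ[k] k[X] :=
  TensorProduct.lift ((LinearMap.mul k k[X]).compl₁₂ φ ψ +
    (X - X ^ 2 : k[X]) • (LinearMap.mul k k[X]).compl₁₂ (φ ∘ₗ y) (Polynomial.derivative ∘ₗ ψ))

theorem prodF_tmul (y : V →ₗ[k] V) (φ : V →ₗ[k] k[X]) (ψ : W →ₗ[k] k[X]) (a : V) (b : W) :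
    prodF y φ ψ (a ⊗ₜ b) = φ a * ψ b + (X - X ^ 2) * (φ (y a) * derivative (ψ b)) := by
  simp [prodF]

theorem prodF_isF {x y : V →ₗ[k] V} {x' y' : W →ₗ[k] W} (hc : ∀ a, x (y a) = y (x a))
    (hyy : ∀ a, y (y a) = 0) {φ : V →ₗ[k] k[X]} {ψ : W →ₗ[k] k[X]} (hφ : IsF x y φ)
    (hψ : IsF x' y' ψ) : IsF (tx x x') (tx y y') (prodF y φ ψ) := by
  intro c
  induction c using TensorProduct.induction_on with
  | zero => simp
  | add a b ha hb => simp only [map_add, ha, hb, mul_add]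
  | tmul a b =>
    simp only [tx_tmul, map_add, prodF_tmul, ← hc, hφ _, hψ _, hyy, map_zero, derivative_mul,
      derivative_X]
    ring

theorem Good.step {m : ℕ} {x y : V →ₗ[k] V} {x' y' : W →ₗ[k] W} (hc : ∀ a, x (y a) = y (x a))
    (hyy : ∀ a, y (y a) = 0) (h : Good m x y) (h' : CaseA x' y') :
    Good (m + 1) (tx x x') (tx y y') := by
  obtain ⟨v, h1, h2, h3, φ, hφ, h4⟩ := h
  obtain ⟨w, ψ, hψ, g1, g2, g3, g4, g5⟩ := h'
  refine ⟨v ⊗ₜ x' w, by simp [tx_tmul, h1, g1], by simp [tx_tmul, h2, g2], fun θ hθ => ?_,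
    prodF y φ ψ, prodF_isF hc hyy hφ hψ, ?_⟩
  · have e1 : θ (v ⊗ₜ x' w) = X * θ (v ⊗ₜ y' w) := by
      have := hθ (v ⊗ₜ w)
      simpa [tx_tmul, h1, h2] using this
    rw [e1, pow_succ']
    refine mul_dvd_mul_left _ (h3 (θ ∘ₗ (TensorProduct.mk k V W).flip (y' w)) fun a => ?_)
    have := hθ (a ⊗ₜ y' w)
    simpa [tx_tmul, g3, g4] using this
  · rw [prodF_tmul, h2, map_zero, zero_mul, mul_zero, add_zero, hψ]
    exact mul_ne_zero h4 (mul_ne_zero X_ne_zero g5)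

theorem rank_bound [FiniteDimensional k V] [CharP k 2] {x y : V →ₗ[k] V}
    (hxx : ∀ a, x (x a) = 0) (hyy : ∀ a, y (y a) = 0)
    (hxy : ∀ a, x (y a) = 0) (hyx : ∀ a, y (x a) = 0) (h : ¬ CaseA x y) :
    2 * Module.finrank k ↥(LinearMap.range x ⊔ LinearMap.range y) ≤ Module.finrank k V := by
  have h0 : ∀ φ, IsF x y φ → ∀ w, φ (y w) = 0 := by
    intro φ hφ w
    by_contra hne
    exact h ⟨w, φ, hφ, hxx _, hyx _, hxy _, hyy _, hne⟩
  set R := LinearMap.range x ⊔ LinearMap.range y with hR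
  let u : (V →ₗ[k] k[X]) →ₗ[k[X]] (V →ₗ[k] k[X]) :=
    LinearMap.lcomp k[X] k[X] x - (X : k[X]) • LinearMap.lcomp k[X] k[X] y
  have hu : ∀ φ a, u φ a = φ (x a) - X * φ (y a) := fun φ a => by simp [u]
  have huu : LinearMap.range u ≤ LinearMap.ker u := by
    rintro _ ⟨φ, rfl⟩
    rw [LinearMap.mem_ker]
    ext1 a
    simp [hu, hxx, hxy, hyx, hyy]
  have hrn := (LinearMap.ker u).finrank_quotient_add_finrank
  rw [u.quotKerEquivRange.finrank_eq] at hrn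
  have h1 := Submodule.finrank_mono huu
  have h2 : Module.finrank k[X] (LinearMap.ker u) ≤ Module.finrank k[X] ((V ⧸ R) →ₗ[k] k[X]) := by
    let j : ((V ⧸ R) →ₗ[k] k[X]) →ₗ[k[X]] (V →ₗ[k] k[X]) := LinearMap.lcomp k[X] k[X] R.mkQ
    have hj : LinearMap.ker u ≤ LinearMap.range j := by
      intro φ hφ
      have hF : IsF x y φ := fun a => by
        have := hu φ a
        rw [LinearMap.mem_ker.1 hφ] at this
        exact (sub_eq_zero.1 this.symm)
      have hle : R ≤ LinearMap.ker φ := by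
        rw [hR, sup_le_iff]
        refine ⟨?_, ?_⟩
        · rintro _ ⟨a, rfl⟩
          rw [LinearMap.mem_ker, hF, h0 φ hF, mul_zero]
        · rintro _ ⟨a, rfl⟩
          rw [LinearMap.mem_ker, h0 φ hF]
      exact ⟨R.liftQ φ hle, by ext1 a; simp [j]⟩
    exact (Submodule.finrank_mono hj).trans (LinearMap.finrank_range_le j)
  rw [Module.finrank_linearMap, Module.finrank_self, mul_one] at hrn h2
  have h3 := R.finrank_quotient_add_finrank
  omega

theorem split [FiniteDimensional k V] [CharP k 2] {x y : V →ₗ[k] V}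
    (hxx : ∀ a, x (x a) = 0) (hyy : ∀ a, y (y a) = 0)
    (hxy : ∀ a, x (y a) = 0) (hyx : ∀ a, y (x a) = 0) (hodd : Odd (Module.finrank k V))
    (h : ¬ CaseA x y) (h' : ¬ CaseA x.dualMap y.dualMap) :
    ∃ (s : V) (f : Module.Dual k V), x s = 0 ∧ y s = 0 ∧ (∀ a, f (x a) = 0) ∧ (∀ a, f (y a) = 0)
      ∧ f s = 1 := by
  have h1 := rank_bound hxx hyy hxy hyx h
  have h2 := rank_bound (x := x.dualMap) (y := y.dualMap) (fun f => by ext; simp [hxx])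
    (fun f => by ext; simp [hyy]) (fun f => by ext; simp [hyx]) (fun f => by ext; simp [hxy]) h'
  rw [Subspace.dual_finrank_eq] at h2
  set S := LinearMap.ker x ⊓ LinearMap.ker y with hS
  set R := LinearMap.range x ⊔ LinearMap.range y with hR
  have h3 : LinearMap.range x.dualMap ⊔ LinearMap.range y.dualMap = S.dualAnnihilator := by
    rw [LinearMap.range_dualMap_eq_dualAnnihilator_ker, LinearMap.range_dualMap_eq_dualAnnihilator_ker, hS,
      Subspace.dualAnnihilator_inf_eq]
  rw [h3] at h2
  have h4 := Subspace.finrank_add_finrank_dualAnnihilator_eq S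
  have h5 : ¬ S ≤ R := fun hle => by
    have := Submodule.finrank_mono hle
    obtain ⟨c, hc⟩ := hodd
    omega
  obtain ⟨s, hs, hsR⟩ := SetLike.not_le_iff_exists.1 h5
  obtain ⟨f, hf, hfR⟩ := Submodule.exists_dual_map_eq_bot_of_notMem hsR inferInstance
  have hker : ∀ r ∈ R, f r = 0 := fun r hr => by
    have : f r ∈ R.map f := ⟨r, hr, rfl⟩
    simpa [hfR] using this
  refine ⟨s, (f s)⁻¹ • f, hs.1, hs.2, fun a => ?_, fun a => ?_, by simp [hf]⟩
  · simp [hker (x a) (Submodule.mem_sup_left ⟨a, rfl⟩)]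
  · simp [hker (y a) (Submodule.mem_sup_right ⟨a, rfl⟩)]

/-- splitting of a free summand -/
theorem proj_split [FiniteDimensional k V] {x y : V →ₗ[k] V}
    (hxx : ∀ a, x (x a) = 0) (hyy : ∀ a, y (y a) = 0)
    (hc : ∀ a, x (y a) = y (x a)) (hodd : Odd (Module.finrank k V))
    (hind : ∀ e : V →ₗ[k] V, (∀ a, e (x a) = x (e a)) → (∀ a, e (y a) = y (e a)) →
      (∀ a, e (e a) = e a) → e = 0 ∨ e = LinearMap.id) (n : V) : x (y n) = 0 := by
  by_contra hne
  obtain ⟨f₀, hf₀⟩ : ∃ f : Module.Dual k V, f (x (y n)) = 1 := by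
    by_contra! hcon
    apply hne
    rw [← Module.forall_dual_apply_eq_zero_iff k]
    intro f
    by_contra hf
    exact hcon ((f (x (y n)))⁻¹ • f) (by simp [hf])
  have hxy2 : ∀ a, y (x (y a)) = 0 := fun a => by rw [hc, hyy]
  obtain ⟨f, f1, f2, f3, f4⟩ : ∃ f : Module.Dual k V,
      f n = 0 ∧ f (x n) = 0 ∧ f (y n) = 0 ∧ f (x (y n)) = 1 := by
    refine ⟨f₀ - f₀ (y n) • f₀ ∘ₗ x - f₀ (x n) • f₀ ∘ₗ y -
      (f₀ n - 2 * f₀ (x n) * f₀ (y n)) • f₀ ∘ₗ x ∘ₗ y, ?_, ?_, ?_, ?_⟩ <;>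
    simp [hf₀, hxx, hyy, ← hc]
    ring
  let e : V →ₗ[k] V := (f ∘ₗ x ∘ₗ y).smulRight n + (f ∘ₗ y).smulRight (x n) +
    (f ∘ₗ x).smulRight (y n) + f.smulRight (x (y n))
  have he : ∀ a, e a = f (x (y a)) • n + f (y a) • x n + f (x a) • y n + f a • x (y n) :=
    fun a => rfl
  have ex : ∀ a, e (x a) = x (e a) := fun a => by simp [he, hxx, ← hc]
  have ey : ∀ a, e (y a) = y (e a) := fun a => by simp [he, hyy, ← hc]
  have en : e n = n := by simp [he, f1, f2, f3, f4]
  have ee : ∀ a, e (e a) = e a := fun a => by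
    rw [he a]; simp only [map_add, map_smul, ex, ey, en]
  rcases hind e ex ey ee with h | h
  · rw [h] at en
    apply hne
    rw [← en]; simp
  · let b : Fin 4 → V := ![n, x n, y n, x (y n)]
    have hli : LinearIndependent k b := by
      rw [Fintype.linearIndependent_iff]
      intro c hcs
      simp only [Fin.sum_univ_four, b] at hcs
      have c0 := congrArg (fun v => f (x (y v))) hcs
      have c1 := congrArg (fun v => f (y v)) hcs
      have c2 := congrArg (fun v => f (x v)) hcs
      have c3 := congrArg f hcs
      simp [hxx, hyy, ← hc, f1, f2, f3, f4] at c0 c1 c2 c3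
      intro i
      fin_cases i <;> simp [*]
    have hsp : ⊤ ≤ Submodule.span k (Set.range b) := by
      intro a _
      have : a = e a := by rw [h]; rfl
      rw [this, he]
      have hb : ∀ i, b i ∈ Submodule.span k (Set.range b) := fun i => Submodule.subset_span ⟨i, rfl⟩
      exact add_mem (add_mem (add_mem (Submodule.smul_mem _ _ (hb 0)) (Submodule.smul_mem _ _ (hb 1)))
        (Submodule.smul_mem _ _ (hb 2))) (Submodule.smul_mem _ _ (hb 3))
    have := Module.finrank_eq_card_basis (Module.Basis.mk hli hsp)
    rw [this] at hodd
    revert hodd; decide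

/-- main dichotomy -/
theorem dichotomy [FiniteDimensional k V] [CharP k 2] {x y : V →ₗ[k] V}
    (hxx : ∀ a, x (x a) = 0) (hyy : ∀ a, y (y a) = 0)
    (hc : ∀ a, x (y a) = y (x a)) (hodd : Odd (Module.finrank k V)) (hdim : 1 < Module.finrank k V)
    (hind : ∀ e : V →ₗ[k] V, (∀ a, e (x a) = x (e a)) → (∀ a, e (y a) = y (e a)) →
      (∀ a, e (e a) = e a) → e = 0 ∨ e = LinearMap.id) :
    CaseA x y ∨ CaseA x.dualMap y.dualMap := by
  by_contra! hcon
  have hxy := proj_split hxx hyy hc hodd hind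
  obtain ⟨s, f, h1, h2, h3, h4, h5⟩ := split hxx hyy hxy (fun a => by rw [← hc, hxy]) hodd
    hcon.1 hcon.2
  rcases hind (f.smulRight s) (fun a => by simp [h1, h3]) (fun a => by simp [h2, h4])
    (fun a => by simp [h5]) with h | h
  · have := congrArg (fun e => f (e s)) h
    simp [h5] at this
  · have : Module.finrank k V ≤ 1 := finrank_le_one s fun a => ⟨f a, by
      have := congrArg (fun e => e a) h
      simpa using this⟩
    omega

theorem Good.dual_step [FiniteDimensional k V] [FiniteDimensional k W] {m : ℕ}
    {x y : V →ₗ[k] V} {x' y' : W →ₗ[k] W} (hc : ∀ a, x (y a) = y (x a))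
    (hyy : ∀ a, y (y a) = 0) (h : Good m x.dualMap y.dualMap) (h' : CaseA x'.dualMap y'.dualMap) :
    Good (m + 1) (tx x x').dualMap (tx y y').dualMap := by
  have := Good.step (x := x.dualMap) (y := y.dualMap) (fun f => by ext; simp [hc])
    (fun f => by ext; simp [hyy]) h h'
  have key : ∀ (x : V →ₗ[k] V) (x' : W →ₗ[k] W) (a), TensorProduct.dualDistribEquiv k V W
      (tx x.dualMap x'.dualMap a) = (tx x x').dualMap (TensorProduct.dualDistribEquiv k V W a) := by
    intro x x' a
    induction a using TensorProduct.induction_on with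
    | zero => simp
    | add a b ha hb => simp only [map_add, ha, hb]
    | tmul f g =>
      apply TensorProduct.ext'
      intro a b
      simp [tx_tmul, TensorProduct.dualDistribEquiv, TensorProduct.dualDistribEquivOfBasis]
  exact this.equiv (TensorProduct.dualDistribEquiv k V W) (key x x') (key y y')

end lin
end V4

namespace V4
section cat
open TensorProduct
variable {k G : Type} [Field k] [Group G]

/-- underlying linear map -/
def homL {M N : FDRep k G} (f : M ⟶ N) : M →ₗ[k] N := f.hom.hom.hom

theorem homL_comm {M N : FDRep k G} (f : M ⟶ N) (q : G) (a : M) :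
    homL f (M.ρ q a) = N.ρ q (homL f a) :=
  ConcreteCategory.congr_hom ((forget (FGModuleCat k)).congr_map (f.comm q)) a

theorem homL_ext {M N : FDRep k G} {f g : M ⟶ N} (h : homL f = homL g) : f = g := by
  apply Action.Hom.ext
  ext1
  exact h

theorem homL_comp {M N P : FDRep k G} (f : M ⟶ N) (g : N ⟶ P) (a : M) :
    homL (f ≫ g) a = homL g (homL f a) := rfl

theorem homL_id {M : FDRep k G} (a : M) : homL (𝟙 M) a = a := rfl

theorem homL_zero {M N : FDRep k G} (a : M) : homL (0 : M ⟶ N) a = 0 := rfl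

/-- build a morphism -/
def mkHom {M N : FDRep k G} (f : M →ₗ[k] N) (h : ∀ q a, f (M.ρ q a) = N.ρ q (f a)) : M ⟶ N :=
  ⟨InducedCategory.homMk (ModuleCat.ofHom f), fun q => by
    ext a
    exact h q a⟩

theorem homL_mkHom {M N : FDRep k G} (f : M →ₗ[k] N) (h) : homL (mkHom f h) = f := rfl

/-- the operator `q - 1` -/
noncomputable def D (M : FDRep k G) (q : G) : M →ₗ[k] M := M.ρ q - 1

theorem D_apply (M : FDRep k G) (q : G) (a : M) : D M q a = M.ρ q a - a := rfl

theorem homL_D {M N : FDRep k G} (f : M ⟶ N) (q : G) (a : M) :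
    homL f (D M q a) = D N q (homL f a) := by
  rw [D_apply, D_apply, map_sub, homL_comm]

theorem D_comm (M : FDRep k G) {g h : G} (hc : g * h = h * g) (a : M) :
    D M g (D M h a) = D M h (D M g a) := by
  have : M.ρ g (M.ρ h a) = M.ρ h (M.ρ g a) := by
    rw [← Module.End.mul_apply, ← map_mul, hc, map_mul, Module.End.mul_apply]
  simp only [D_apply, map_sub, this]
  abel

theorem D_sq [CharP k 2] (M : FDRep k G) {g : G} (hg : g * g = 1) (a : M) :
    D M g (D M g a) = 0 := by
  have : M.ρ g (M.ρ g a) = a := by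
    rw [← Module.End.mul_apply, ← map_mul, hg, map_one, Module.End.one_apply]
  have h2 : (2 : k) = 0 := CharTwo.two_eq_zero
  simp only [D_apply, map_sub, this]
  have : a - M.ρ g a - (M.ρ g a - a) = (2 : k) • (a - M.ρ g a) := by
    rw [two_smul]; abel
  rw [this, h2, zero_smul]

theorem D_tensor (M N : FDRep k G) (q : G) : D (M ⊗ N) q = tx (D M q) (D N q) := by
  apply TensorProduct.ext'
  intro a b
  rw [tx_tmul]
  have : (M ⊗ N).ρ q (a ⊗ₜ[k] b) = M.ρ q a ⊗ₜ[k] N.ρ q b := rfl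
  have e : D (M ⊗ N) q (a ⊗ₜ[k] b) = M.ρ q a ⊗ₜ[k] N.ρ q b - a ⊗ₜ[k] b := rfl
  refine e.trans ?_
  simp only [D_apply, TensorProduct.sub_tmul, TensorProduct.tmul_sub]
  abel

/-- both bounds -/
def BB (b : ℕ) (g h : G) (M : FDRep k G) : Prop :=
  Bdd b (D M g) (D M h) ∧ Bdd b (D M g).dualMap (D M h).dualMap

theorem BB.sum {b : ℕ} {g h : G} {P Y Z : FDRep k G} (i : Y ⟶ P) (r : P ⟶ Y) (j : Z ⟶ P)
    (s : P ⟶ Z) (hsum : ∀ a, homL i (homL r a) + homL j (homL s a) = a)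
    (hY : BB b g h Y) (hZ : BB b g h Z) : BB b g h P := by
  constructor
  · intro v hv φ hφ
    rw [← hsum v, map_add, hY.1.retract (homL i) (homL r) (homL_D i g) (homL_D i h) (homL_D r g)
      (homL_D r h) v hv φ hφ, hZ.1.retract (homL j) (homL s) (homL_D j g) (homL_D j h) (homL_D s g)
      (homL_D s h) v hv φ hφ, add_zero]
  · intro v hv φ hφ
    have hd : ∀ {M N : FDRep k G} (f : M ⟶ N) (q : G) (a : Module.Dual k N),
        (homL f).dualMap ((D N q).dualMap a) = (D M q).dualMap ((homL f).dualMap a) := by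
      intro M N f q a
      ext c
      simp [homL_D]
    have hs : (homL r).dualMap ((homL i).dualMap v) + (homL s).dualMap ((homL j).dualMap v) = v := by
      ext a
      simp only [LinearMap.add_apply, LinearMap.dualMap_apply]
      rw [← map_add, hsum]
    rw [← hs, map_add, hY.2.retract (homL r).dualMap (homL i).dualMap (hd r g) (hd r h) (hd i g)
      (hd i h) v hv φ hφ, hZ.2.retract (homL s).dualMap (homL j).dualMap (hd s g) (hd s h) (hd j g)
      (hd j h) v hv φ hφ, add_zero]

theorem BB.iso {b : ℕ} {g h : G} {P Y : FDRep k G} (e : P ≅ Y) (hY : BB b g h Y) :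
    BB b g h P :=
  BB.sum e.inv e.hom e.inv (0 : P ⟶ Y) (fun a => by
    rw [homL_zero, map_zero, add_zero, ← homL_comp, e.hom_inv_id]; rfl) hY hY

theorem BB.of_isZero (b : ℕ) (g h : G) {P : FDRep k G} (hP : Limits.IsZero P) : BB b g h P := by
  have h0 : ∀ a : P, a = 0 := fun a => by
    have := hP.eq_of_src (𝟙 P) 0
    rw [← homL_id a, this]; rfl
  constructor
  · intro v _ φ _
    rw [h0 v, map_zero]
  · intro v _ φ _
    have : v = 0 := by ext a; rw [h0 a, map_zero, map_zero]
    rw [this, map_zero]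

theorem exists_BB (g h : G) (M : FDRep k G) : ∃ b, ∀ c, b ≤ c → BB c g h M := by
  obtain ⟨b, hb⟩ := exists_bdd (D M g) (D M h)
  obtain ⟨c, hc⟩ := exists_bdd (D M g).dualMap (D M h).dualMap
  exact ⟨max b c, fun d hd => ⟨hb.mono ((le_max_left _ _).trans hd),
    hc.mono ((le_max_right _ _).trans hd)⟩⟩

theorem exists_BB_list (g h : G) (L : List (FDRep k G)) : ∃ b, ∀ M ∈ L, BB b g h M := by
  suffices ∃ b, ∀ c, b ≤ c → ∀ M ∈ L, BB c g h M by
    obtain ⟨b, hb⟩ := this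
    exact ⟨b, hb b le_rfl⟩
  induction L with
  | nil => exact ⟨0, by simp⟩
  | cons M L ih =>
    obtain ⟨b, hb⟩ := ih
    obtain ⟨c, hc⟩ := exists_BB g h M
    refine ⟨max b c, fun d hd N hN => ?_⟩
    rcases List.mem_cons.1 hN with rfl | hN
    · exact hc d ((le_max_right _ _).trans hd)
    · exact hb d ((le_max_left _ _).trans hd) N hN

theorem split_idem {P : FDRep k G} (e : P ⟶ P) (he : e ≫ e = e) (hne : e ≠ 𝟙 P) :
    ∃ (Y : FDRep k G) (i : Y ⟶ P) (r : P ⟶ Y), i ≫ r = 𝟙 Y ∧ r ≫ i = e ∧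
      Module.finrank k Y < Module.finrank k P := by
  obtain ⟨Y, i, r, h1, h2⟩ := IsIdempotentComplete.idempotents_split P e he
  refine ⟨Y, i, r, h1, h2, ?_⟩
  have hri : ∀ a, homL r (homL i a) = a := fun a => by rw [← homL_comp, h1]; rfl
  have hinj : Function.Injective (homL i) := Function.LeftInverse.injective hri
  have hle := LinearMap.finrank_le_finrank_of_injective hinj
  refine lt_of_le_of_ne hle fun heq => hne ?_
  have hsurj := (LinearMap.injective_iff_surjective_of_finrank_eq_finrank heq).1 hinj
  apply homL_ext
  ext a
  obtain ⟨c, rfl⟩ := hsurj a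
  rw [← h2, homL_comp, hri]; rfl

theorem BB.of_indec {b : ℕ} {g h : G} : ∀ (n : ℕ) (P : FDRep k G), Module.finrank k P = n →
    (∀ N : FDRep k G, AlgebraicModule.Indecomposable N → IsSummand N P → BB b g h N) → BB b g h P := by
  intro n
  induction n using Nat.strong_induction_on with
  | _ n ih =>
    intro P hn H
    by_cases hz : Limits.IsZero P
    · exact BB.of_isZero b g h hz
    by_cases hi : AlgebraicModule.Indecomposable P
    · exact H P hi ⟨𝟙 P, 𝟙 P, Category.comp_id _⟩
    have : ∃ e : P ⟶ P, e ≫ e = e ∧ e ≠ 0 ∧ e ≠ 𝟙 P := by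
      by_contra! hcon
      exact hi ⟨hz, fun e he => or_iff_not_imp_left.2 (hcon e he)⟩
    obtain ⟨e, he, h0, h1⟩ := this
    have he' : (𝟙 P - e) ≫ (𝟙 P - e) = 𝟙 P - e := by
      simp [Preadditive.sub_comp, Preadditive.comp_sub, he]
    obtain ⟨Y, i, r, hir, hri, hlt⟩ := split_idem e he h1
    obtain ⟨Z, j, s, hjs, hsj, hlt'⟩ := split_idem (𝟙 P - e) he' (by simpa using h0)
    have trans : ∀ {Y : FDRep k G} (i : Y ⟶ P) (r : P ⟶ Y), i ≫ r = 𝟙 Y →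
        ∀ N, IsSummand N Y → IsSummand N P := by
      rintro Y i r hir N ⟨a, c, hac⟩
      refine ⟨a ≫ i, r ≫ c, ?_⟩
      rw [Category.assoc, ← Category.assoc i, hir, Category.id_comp, hac]
    refine BB.sum i r j s (fun a => ?_)
      (ih _ (hn ▸ hlt) Y rfl fun N hN hs => H N hN (trans i r hir N hs))
      (ih _ (hn ▸ hlt') Z rfl fun N hN hs => H N hN (trans j s hjs N hs))
    rw [← homL_comp, ← homL_comp, hri, hsj]
    show homL e a + (homL (𝟙 P) a - homL e a) = a
    rw [homL_id]; abel

theorem good_pow [CharP k 2] {M : FDRep k G} {g h : G} (hc : g * h = h * g) (hh : h * h = 1)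
    (hA : CaseA (D M g) (D M h)) (n : ℕ) :
    Good (n + 1) (D (tensorPow M n) g) (D (tensorPow M n) h) := by
  induction n with
  | zero => exact Good.base hA
  | succ n ih =>
    have := Good.step (D_comm _ hc) (D_sq _ hh) ih hA
    rw [← D_tensor, ← D_tensor] at this
    exact this

theorem good_pow_dual [CharP k 2] {M : FDRep k G} {g h : G} (hc : g * h = h * g) (hh : h * h = 1)
    (hA : CaseA (D M g).dualMap (D M h).dualMap) (n : ℕ) :
    Good (n + 1) (D (tensorPow M n) g).dualMap (D (tensorPow M n) h).dualMap := by
  induction n with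
  | zero => exact Good.base hA
  | succ n ih =>
    have := Good.dual_step (D_comm _ hc) (D_sq _ hh) ih hA
    rw [← D_tensor, ← D_tensor] at this
    exact this

theorem main [CharP k 2] {M : FDRep k G} {g h : G} (hc : g * h = h * g) (hh : h * h = 1)
    (hA : CaseA (D M g) (D M h) ∨ CaseA (D M g).dualMap (D M h).dualMap) : ¬ IsAlgebraic M := by
  rintro ⟨L, hL⟩
  obtain ⟨b, hb⟩ := exists_BB_list g h L
  have : BB b g h (tensorPow M b) := by
    refine BB.of_indec _ _ rfl fun N hN hs => ?_
    obtain ⟨N', hN', ⟨e⟩⟩ := hL N hN ⟨b, hs⟩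
    exact (hb N' hN').iso e
  rcases hA with hA | hA
  · exact (good_pow hc hh hA b).not_bdd (Nat.le_succ b) this.1
  · exact (good_pow_dual hc hh hA b).not_bdd (Nat.le_succ b) this.2

end cat
end V4

/-- The `V_4` restriction test: if `Q ≤ G` is a Klein four subgroup, `k` is an
algebraically closed field of characteristic `2`, and the restriction of `M` to `Q` has an
indecomposable direct summand of odd dimension greater than `1`, then `M` is non-algebraic. -/
theorem v4_restriction_test (G : Type) [Group G] [Finite G] (Q : Subgroup G)
    (hQ : Nonempty (Q ≃* (Multiplicative (ZMod 2) × Multiplicative (ZMod 2))))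
    (k : Type) [Field k] [IsAlgClosed k] (hk : CharP k 2)
    (M : FDRep k G) (N : FDRep k Q)
    (hN : AlgebraicModule.Indecomposable N) (hsum : IsSummand N (resModule Q M))
    (hodd : Odd (Module.finrank k N)) (hdim : 1 < Module.finrank k N) :
    ¬ IsAlgebraic M := by
  obtain ⟨f⟩ := hQ
  obtain ⟨i, r, hir⟩ := hsum
  have hex : ∃ g h : Q, g * g = 1 ∧ h * h = 1 ∧ g * h = h * g ∧
      ∀ q : Q, q = 1 ∨ q = g ∨ q = h ∨ q = g * h := by
    refine ⟨f.symm (Multiplicative.ofAdd 1, 1), f.symm (1, Multiplicative.ofAdd 1), ?_, ?_, ?_, ?_⟩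
    · rw [← map_mul, ← map_one f.symm]; congr 1
    · rw [← map_mul, ← map_one f.symm]; congr 1
    · rw [← map_mul, ← map_mul]; congr 1
    · intro q
      obtain ⟨p, rfl⟩ := f.symm.surjective q
      rw [← map_mul, ← map_one f.symm]
      simp only [f.symm.injective.eq_iff]
      revert p
      decide
  obtain ⟨g, h, hg, hh, hc, hall⟩ := hex
  have hD : V4.CaseA (V4.D N g) (V4.D N h) ∨
      V4.CaseA (V4.D N g).dualMap (V4.D N h).dualMap := by
    refine V4.dichotomy (V4.D_sq N hg) (V4.D_sq N hh) (V4.D_comm N hc) hodd hdim ?_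
    intro e ex ey ee
    have eg : ∀ a, e (N.ρ g a) = N.ρ g (e a) := fun a => by
      have := ex a
      rwa [V4.D_apply, V4.D_apply, map_sub, sub_left_inj] at this
    have eh : ∀ a, e (N.ρ h a) = N.ρ h (e a) := fun a => by
      have := ey a
      rwa [V4.D_apply, V4.D_apply, map_sub, sub_left_inj] at this
    have eq : ∀ q a, e (N.ρ q a) = N.ρ q (e a) := by
      intro q a
      rcases hall q with rfl | rfl | rfl | rfl
      · simp
      · exact eg a
      · exact eh a
      · rw [map_mul, Module.End.mul_apply, Module.End.mul_apply, eg, eh]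
    rcases hN.2 (V4.mkHom e eq) (V4.homL_ext (LinearMap.ext ee)) with h0 | h0
    · left
      rw [← V4.homL_mkHom e eq, h0]; rfl
    · right
      rw [← V4.homL_mkHom e eq, h0]; rfl
  have hri : ∀ a, V4.homL r (V4.homL i a) = a := fun a => by rw [← V4.homL_comp, hir]; rfl
  have hM : V4.CaseA (V4.D (resModule Q M) g) (V4.D (resModule Q M) h) ∨
      V4.CaseA (V4.D (resModule Q M) g).dualMap (V4.D (resModule Q M) h).dualMap := by
    have hd : ∀ {M N : FDRep k Q} (f : M ⟶ N) (q : Q) (a : Module.Dual k N),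
        (V4.homL f).dualMap ((V4.D N q).dualMap a) = (V4.D M q).dualMap ((V4.homL f).dualMap a) := by
      intro M N f q a
      ext c
      simp [V4.homL_D]
    rcases hD with hD | hD
    · exact Or.inl (hD.retract (V4.homL i) (V4.homL r) hri (V4.homL_D i g) (V4.homL_D i h)
        (V4.homL_D r g) (V4.homL_D r h))
    · refine Or.inr (hD.retract (V4.homL r).dualMap (V4.homL i).dualMap (fun a => ?_) (hd r g)
        (hd r h) (hd i g) (hd i h))
      ext c
      simp [hri]
  exact V4.main (M := M) (g := (g : G)) (h := (h : G)) (by exact_mod_cast congrArg Subtype.val hc)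
    (by exact_mod_cast congrArg Subtype.val hh) hM
end

section
/- Let p be a prime, k the field with p elements, P = C_p × C_p the elementary abelian group of order p^2, and J the Jacobson radical of the group algebra kP. Then the quotient module M_2 = kP/J^2 is a 3-dimensional kP-module which is non-algebraic. -/
open CategoryTheory CategoryTheory.MonoidalCategory

open AlgebraicModule

/-- The elementary abelian group `C_p × C_p` of order `p^2` (written multiplicatively). -/
abbrev Pgrp (p : ℕ) := Multiplicative (ZMod p × ZMod p)

/-- The group algebra `kP` of `P = C_p × C_p` over `k = F_p`. -/
abbrev GrpAlg (p : ℕ) := MonoidAlgebra (ZMod p) (Pgrp p)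

/-- The Jacobson radical `J` of the group algebra `kP`. -/
noncomputable def Jrad (p : ℕ) [Fact p.Prime] : Ideal (GrpAlg p) := Ideal.jacobson ⊥

noncomputable instance (p : ℕ) [Fact p.Prime] : Module.Finite (ZMod p) (GrpAlg p) :=
  Module.Finite.of_basis (MonoidAlgebra.basis (Pgrp p) (ZMod p))

noncomputable instance (p : ℕ) [Fact p.Prime] (i : ℕ) :
    Module.Finite (ZMod p) (GrpAlg p ⧸ (Jrad p ^ i)) :=
  Module.Finite.of_surjective (Ideal.Quotient.mkₐ (ZMod p) (Jrad p ^ i)).toLinearMap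
    (Ideal.Quotient.mkₐ_surjective (ZMod p) _)

/-- The quotient `kP ⧸ J^i` as a representation of `P = C_p × C_p`, with `g ∈ P` acting by
left multiplication by the corresponding group algebra element. -/
noncomputable def radQuotRep (p : ℕ) [Fact p.Prime] (i : ℕ) :
    Representation (ZMod p) (Pgrp p) (GrpAlg p ⧸ (Jrad p ^ i)) where
  toFun g := LinearMap.mulLeft (ZMod p)
    (Ideal.Quotient.mk (Jrad p ^ i) (MonoidAlgebra.of (ZMod p) (Pgrp p) g))
  map_one' := by
    show LinearMap.mulLeft (ZMod p) _ = _
    rw [map_one, map_one, LinearMap.mulLeft_one]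
    rfl
  map_mul' g h := by
    show LinearMap.mulLeft (ZMod p) _ =
      LinearMap.mulLeft (ZMod p) _ * LinearMap.mulLeft (ZMod p) _
    rw [map_mul, map_mul, LinearMap.mulLeft_mul]
    rfl

/-! ## Underlying linear maps of morphisms -/

namespace RQ

section General

variable {k G : Type} [Field k] [CommGroup G]

/-- The underlying linear map of a morphism of representations. -/
noncomputable def lin {A B : FDRep k G} (φ : A ⟶ B) : A →ₗ[k] B := φ.hom.hom.hom

lemma lin_comp {A B C : FDRep k G} (φ : A ⟶ B) (ψ : B ⟶ C) (v : A) :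
    lin (φ ≫ ψ) v = lin ψ (lin φ v) := rfl

lemma lin_id {A : FDRep k G} (v : A) : lin (𝟙 A) v = v := rfl

lemma lin_sub {A B : FDRep k G} (φ ψ : A ⟶ B) (v : A) :
    lin (φ - ψ) v = lin φ v - lin ψ v := rfl

lemma lin_equivariant {A B : FDRep k G} (φ : A ⟶ B) (g : G) (v : A) :
    lin φ (A.ρ g v) = B.ρ g (lin φ v) :=
  ConcreteCategory.congr_hom ((forget (FGModuleCat k)).congr_map (φ.comm g)) v

lemma lin_injective {A B : FDRep k G} {φ ψ : A ⟶ B} (h : ∀ v, lin φ v = lin ψ v) : φ = ψ := by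
  apply Action.Hom.ext
  apply InducedCategory.hom_ext
  apply ModuleCat.hom_ext
  exact LinearMap.ext h

/-! ## The filtration -/

/-- `v` lies in the image of `(g - 1) + t (h - 1)` on `N[t]/t^m`. -/
noncomputable def filt (g h : G) (N : FDRep k G) (m : ℕ) : Submodule k N where
  carrier := {v | ∃ u : ℕ → N, (0 < m → N.ρ g (u 0) - u 0 = v) ∧
    ∀ j, j + 1 < m → N.ρ g (u (j + 1)) - u (j + 1) = -(N.ρ h (u j) - u j)}
  zero_mem' := ⟨fun _ => 0, by simp, by simp⟩
  add_mem' := by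
    rintro a b ⟨u, hu0, hu⟩ ⟨w, hw0, hw⟩
    refine ⟨fun j => u j + w j, fun hm => ?_, fun j hj => ?_⟩
    · change N.ρ g (u 0 + w 0) - (u 0 + w 0) = a + b
      rw [← hu0 hm, ← hw0 hm, map_add, add_sub_add_comm]
    · have h1 := hu j hj
      have h2 := hw j hj
      change N.ρ g (u (j + 1) + w (j + 1)) - (u (j + 1) + w (j + 1)) =
        -(N.ρ h (u j + w j) - (u j + w j))
      rw [map_add, map_add, add_sub_add_comm, add_sub_add_comm, h1, h2, neg_add]
  smul_mem' := by
    rintro c a ⟨u, hu0, hu⟩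
    refine ⟨fun j => c • u j, fun hm => ?_, fun j hj => ?_⟩
    · rw [← hu0 hm, map_smul, smul_sub]
    · rw [map_smul, map_smul, ← smul_sub, ← smul_sub, hu j hj, smul_neg]

lemma filt_anti (g h : G) (N : FDRep k G) : Antitone (filt g h N) := by
  rintro a b hab v ⟨u, hu0, hu⟩
  exact ⟨u, fun hm => hu0 (hm.trans_le hab), fun j hj => hu j (hj.trans_le hab)⟩

lemma filt_map (g h : G) {A B : FDRep k G} (φ : A ⟶ B) (m : ℕ) {v : A}
    (hv : v ∈ filt g h A m) : lin φ v ∈ filt g h B m := by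
  obtain ⟨u, hu0, hu⟩ := hv
  refine ⟨fun j => lin φ (u j), fun hm => ?_, fun j hj => ?_⟩
  · rw [← hu0 hm, map_sub, lin_equivariant]
  · rw [← lin_equivariant, ← lin_equivariant, ← map_sub, ← map_sub, hu j hj, map_neg]

/-- The filtration is stationary from `D` on. -/
def Stat (g h : G) (D : ℕ) (N : FDRep k G) : Prop :=
  ∀ m v, v ∈ filt g h N D → v ∈ filt g h N m

lemma Stat.mono {g h : G} {D E : ℕ} (hDE : D ≤ E) {N : FDRep k G} (H : Stat g h D N) :
    Stat g h E N := fun m v hv => H m v (filt_anti g h N hDE hv)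

lemma exists_stat (g h : G) (N : FDRep k G) : ∃ D, Stat g h D N := by
  obtain ⟨D, hD⟩ := IsArtinian.monotone_stabilizes
    (⟨fun n => OrderDual.toDual (filt g h N n), fun a b hab => filt_anti g h N hab⟩ :
      ℕ →o (Submodule k N)ᵒᵈ)
  refine ⟨D, fun m v hv => ?_⟩
  rcases le_total D m with hm | hm
  · have : filt g h N D = filt g h N m := hD m hm
    rwa [← this]
  · exact filt_anti g h N hm hv

lemma exists_stat_list (g h : G) (L : List (FDRep k G)) : ∃ D, ∀ N ∈ L, Stat g h D N := by
  induction L with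
  | nil => exact ⟨0, by simp⟩
  | cons A L ih =>
    obtain ⟨D, hD⟩ := ih
    obtain ⟨E, hE⟩ := exists_stat g h A
    refine ⟨max D E, fun N hN => ?_⟩
    rcases List.mem_cons.1 hN with rfl | hN
    · exact hE.mono (le_max_right _ _)
    · exact (hD N hN).mono (le_max_left _ _)

lemma Stat.of_iso {g h : G} {D : ℕ} {A B : FDRep k G} (e : A ≅ B) (H : Stat g h D B) :
    Stat g h D A := by
  intro m v hv
  have := filt_map g h e.inv m (H m _ (filt_map g h e.hom D hv))
  rwa [← lin_comp, e.hom_inv_id, lin_id] at this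

lemma finrank_lt_of_split {N Y : FDRep k G} {i : Y ⟶ N} {r : N ⟶ Y} (h1 : i ≫ r = 𝟙 Y)
    (h2 : r ≫ i ≠ 𝟙 N) : Module.finrank k Y < Module.finrank k N := by
  have hinj : Function.Injective (lin i) := by
    intro a b hab
    have := congrArg (lin r) hab
    rwa [← lin_comp, ← lin_comp, h1, lin_id, lin_id] at this
  refine lt_of_le_of_ne (LinearMap.finrank_le_finrank_of_injective hinj) fun heq => h2 ?_
  have hsurj := (LinearMap.injective_iff_surjective_of_finrank_eq_finrank heq).1 hinj
  apply lin_injective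
  intro v
  obtain ⟨y, rfl⟩ := hsurj v
  rw [lin_comp, ← lin_comp i r, h1, lin_id, lin_id]

lemma IsSummand.trans' {A B C : FDRep k G} (h1 : IsSummand A B) (h2 : IsSummand B C) :
    IsSummand A C := by
  obtain ⟨i, r, h⟩ := h1
  obtain ⟨i', r', h'⟩ := h2
  exact ⟨i ≫ i', r' ≫ r, by rw [Category.assoc, ← Category.assoc i', h', Category.id_comp, h]⟩

/-- If every indecomposable summand of `N` is stationary from `D` on, so is `N`. -/
lemma stat_of_indecomposable (g h : G) (D : ℕ) : ∀ (d : ℕ) (N : FDRep k G),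
    Module.finrank k N = d →
    (∀ A : FDRep k G, AlgebraicModule.Indecomposable A → IsSummand A N → Stat g h D A) → Stat g h D N := by
  intro d
  induction d using Nat.strong_induction_on with
  | _ d ih =>
    intro N hd H
    by_cases hz : Limits.IsZero N
    · intro m v _
      have h0 : 𝟙 N = 0 := hz.eq_of_src _ _
      have : v = 0 := by
        rw [← lin_id v, h0]; rfl
      rw [this]; exact Submodule.zero_mem _
    by_cases hN : AlgebraicModule.Indecomposable N
    · exact H N hN ⟨𝟙 N, 𝟙 N, Category.id_comp _⟩
    have : ∃ e : N ⟶ N, e ≫ e = e ∧ e ≠ 0 ∧ e ≠ 𝟙 N := by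
      by_contra! hcon
      exact hN ⟨hz, fun e he => or_iff_not_imp_left.2 (hcon e he)⟩
    obtain ⟨e, he, he0, he1⟩ := this
    have he' : (𝟙 N - e) ≫ (𝟙 N - e) = 𝟙 N - e := by
      simp [Preadditive.sub_comp, Preadditive.comp_sub, he]
    obtain ⟨A, i, r, hir, hri⟩ := IsIdempotentComplete.idempotents_split N e he
    obtain ⟨B, j, s, hjs, hsj⟩ := IsIdempotentComplete.idempotents_split N _ he'
    have hA : Stat g h D A := by
      refine ih _ ?_ A rfl fun C hC hCA => H C hC (IsSummand.trans' hCA ⟨i, r, hir⟩)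
      rw [← hd]; exact finrank_lt_of_split hir (by rwa [hri])
    have hB : Stat g h D B := by
      refine ih _ ?_ B rfl fun C hC hCA => H C hC (IsSummand.trans' hCA ⟨j, s, hjs⟩)
      rw [← hd]; exact finrank_lt_of_split hjs (by
        rw [hsj]; intro h'; apply he0; simpa using h')
    intro m v hv
    have h1 := filt_map g h i m (hA m _ (filt_map g h r D hv))
    have h2 := filt_map g h j m (hB m _ (filt_map g h s D hv))
    rw [← lin_comp, hri] at h1
    rw [← lin_comp, hsj, lin_sub, lin_id] at h2
    have := Submodule.add_mem _ h1 h2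
    rwa [add_sub_cancel] at this

/-! ## Tensor powers -/

lemma tensor_apply (A B : FDRep k G) (g : G) (a : A) (b : B) :
    (A ⊗ B).ρ g (TensorProduct.tmul k a b) = TensorProduct.tmul k (A.ρ g a) (B.ρ g b) := rfl

open Polynomial in
/-- A functional with values in `k[t]` killing the image of `(g - 1) + t (h - 1)`. -/
def Good (g h : G) (N : FDRep k G) (f : N →ₗ[k] k[X]) : Prop :=
  ∀ n : N, f (N.ρ g n) + X * f (N.ρ h n) = (1 + X) * f n

open Polynomial in
lemma Good.dvd {g h : G} {N : FDRep k G} {f : N →ₗ[k] k[X]} (hf : Good g h N f) {m : ℕ} {v : N}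
    (hv : v ∈ filt g h N m) : X ^ m ∣ f v := by
  obtain ⟨u, hu0, hu⟩ := hv
  have key : ∀ n : N, f (N.ρ g n - n) = - (X * f (N.ρ h n - n)) := by
    intro n
    have := hf n
    rw [map_sub, map_sub]
    linear_combination this
  have step : ∀ j, j < m → f v = X ^ j * f (N.ρ g (u j) - u j) := by
    intro j
    induction j with
    | zero => intro hm; rw [hu0 hm]; simp
    | succ j ih =>
      intro hj
      rw [ih (by omega), hu j hj, key, map_neg]; ring
  rcases m with _ | m
  · simp
  · rw [step m (by omega), key]
    exact ⟨-f (N.ρ h (u m) - u m), by ring⟩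

/-- The data on `M = kP / J^2` that we use. -/
structure Data (g h : G) (M : FDRep k G) where
  one : M
  X : M
  Y : M
  α : M →ₗ[k] k
  β : M →ₗ[k] k
  ε : M →ₗ[k] k
  g_one : M.ρ g one = one + X
  h_one : M.ρ h one = one + Y
  gX : M.ρ g X = X
  hX : M.ρ h X = X
  gY : M.ρ g Y = Y
  hY : M.ρ h Y = Y
  αX : α X = 1
  βX : β X = 0
  αg : ∀ m, α (M.ρ g m) = α m + ε m
  αh : ∀ m, α (M.ρ h m) = α m
  βg : ∀ m, β (M.ρ g m) = β m
  βh : ∀ m, β (M.ρ h m) = β m + ε m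

lemma rho_mul (N : FDRep k G) (a b : G) (n : N) : N.ρ a (N.ρ b n) = N.ρ (a * b) n := by
  rw [map_mul]; rfl

/-- The vector `X ⊗ X ⊗ ... ⊗ X`. -/
noncomputable def vec {g h : G} {M : FDRep k G} (d : Data g h M) : (n : ℕ) → tensorPow M n
  | 0 => d.X
  | n + 1 => TensorProduct.tmul k (vec d n) d.X

lemma vec_fixed {g h : G} {M : FDRep k G} (d : Data g h M) (n : ℕ) :
    (tensorPow M n).ρ g (vec d n) = vec d n ∧ (tensorPow M n).ρ h (vec d n) = vec d n := by
  induction n with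
  | zero => exact ⟨d.gX, d.hX⟩
  | succ n ih =>
    constructor
    · refine (tensor_apply (tensorPow M n) M g (vec d n) d.X).trans ?_
      rw [ih.1, d.gX]; rfl
    · refine (tensor_apply (tensorPow M n) M h (vec d n) d.X).trans ?_
      rw [ih.2, d.hX]; rfl

lemma mem_filt_tensor {g h : G} {M : FDRep k G} (d : Data g h M) (N : FDRep k G) (m : ℕ) (v : N)
    (hg : N.ρ g v = v) (hh : N.ρ h v = v) (hv : v ∈ filt g h N m) (hm : 0 < m) :
    (TensorProduct.tmul k v d.X : (N ⊗ M : FDRep k G)) ∈ filt g h (N ⊗ M) (m + 1) := by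
  obtain ⟨u, hu0, hu⟩ := hv
  let w : ℕ → TensorProduct k N M := fun j => match j with
    | 0 => TensorProduct.tmul k v d.one
    | j + 1 => TensorProduct.tmul k (-u j) d.Y
  refine ⟨w, fun _ => ?_, fun j hj => ?_⟩
  · change TensorProduct.tmul k (N.ρ g v) (M.ρ g d.one) - TensorProduct.tmul k v d.one =
      TensorProduct.tmul k v d.X
    rw [hg, d.g_one, TensorProduct.tmul_add, add_sub_cancel_left]
  · rcases j with _ | j
    · change TensorProduct.tmul k (N.ρ g (-u 0)) (M.ρ g d.Y) - TensorProduct.tmul k (-u 0) d.Y =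
        -(TensorProduct.tmul k (N.ρ h v) (M.ρ h d.one) - TensorProduct.tmul k v d.one)
      rw [hh, d.gY, d.h_one, TensorProduct.tmul_add, add_sub_cancel_left, ← hu0 hm,
        ← TensorProduct.sub_tmul, ← TensorProduct.neg_tmul, map_neg]
      congr 1; abel
    · change TensorProduct.tmul k (N.ρ g (-u (j + 1))) (M.ρ g d.Y)
          - TensorProduct.tmul k (-u (j + 1)) d.Y =
        -(TensorProduct.tmul k (N.ρ h (-u j)) (M.ρ h d.Y) - TensorProduct.tmul k (-u j) d.Y)
      have := hu j (by omega)
      rw [d.gY, d.hY, ← TensorProduct.sub_tmul, ← TensorProduct.sub_tmul, ← TensorProduct.neg_tmul,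
        map_neg, map_neg]
      congr 1
      rw [← neg_sub', this]; abel

lemma vec_mem {g h : G} {M : FDRep k G} (d : Data g h M) (n : ℕ) :
    vec d n ∈ filt g h (tensorPow M n) (n + 1) := by
  induction n with
  | zero =>
    refine ⟨fun _ => d.one, fun _ => ?_, fun j hj => absurd hj (by omega)⟩
    change M.ρ g d.one - d.one = d.X
    rw [d.g_one, add_sub_cancel_left]
  | succ n ih =>
    exact mem_filt_tensor d _ _ _ (vec_fixed d n).1 (vec_fixed d n).2 ih (by omega)

open Polynomial in
/-- The inductive construction of functionals. -/
noncomputable def ext {g h : G} {M : FDRep k G} (d : Data g h M) (N : FDRep k G)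
    (f : N →ₗ[k] k[X]) : TensorProduct k N M →ₗ[k] k[X] :=
  TensorProduct.lift (LinearMap.mk₂ k
    (fun n m => - X * (d.α m • f (N.ρ g⁻¹ n)) + d.β m • f (N.ρ h⁻¹ n))
    (by intros; simp only [map_add, smul_add]; ring)
    (by intros; simp only [map_smul, smul_add, smul_comm (_ : k) (_ : k), mul_smul_comm])
    (by intros; simp only [map_add, add_smul]; ring)
    (by intros; simp only [map_smul, smul_add, smul_assoc, mul_smul_comm]))

open Polynomial in
lemma ext_good {g h : G} {M : FDRep k G} (d : Data g h M) (N : FDRep k G)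
    (f : N →ₗ[k] k[X]) (hf : Good g h N f) : Good g h (N ⊗ M) (ext d N f) := by
  have key : ∀ z : TensorProduct k N M,
      ext d N f (TensorProduct.map (N.ρ g) (M.ρ g) z) +
        X * ext d N f (TensorProduct.map (N.ρ h) (M.ρ h) z) = (1 + X) * ext d N f z := by
    intro z
    induction z using TensorProduct.induction_on with
    | zero => simp
    | add a b ha hb => simp only [map_add]; linear_combination ha + hb
    | tmul n m =>
      simp only [TensorProduct.map_tmul, ext, TensorProduct.lift.tmul, LinearMap.mk₂_apply,
        d.αg, d.αh, d.βg, d.βh, rho_mul, inv_mul_cancel, map_one, Module.End.one_apply]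
      have h1 := hf (N.ρ g⁻¹ n)
      have h2 := hf (N.ρ h⁻¹ n)
      simp only [rho_mul, mul_inv_cancel, map_one, Module.End.one_apply] at h1 h2
      rw [mul_comm g h⁻¹] at h2
      rw [mul_comm h g⁻¹] at h1
      simp only [smul_eq_C_mul, map_add]
      linear_combination (- X * C (d.α m)) * h1 + C (d.β m) * h2
  exact key

open Polynomial in
lemma exists_good {g h : G} {M : FDRep k G} (d : Data g h M) (n : ℕ) :
    ∃ f : tensorPow M n →ₗ[k] k[X], Good g h _ f ∧ f (vec d n) = (- X) ^ (n + 1) := by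
  induction n with
  | zero =>
    refine ⟨(LinearMap.mulLeft k (-X : k[X])) ∘ₗ (Algebra.linearMap k k[X]) ∘ₗ d.α +
      (Algebra.linearMap k k[X]) ∘ₗ d.β, ?_, ?_⟩
    · have key : ∀ m : M, (-X * C (d.α (M.ρ g m)) + C (d.β (M.ρ g m))) +
          X * (-X * C (d.α (M.ρ h m)) + C (d.β (M.ρ h m))) =
          (1 + X) * (-X * C (d.α m) + C (d.β m)) := by
        intro m
        rw [d.αg, d.αh, d.βg, d.βh]
        simp only [map_add]; ring
      exact key
    · change -X * C (d.α d.X) + C (d.β d.X) = _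
      rw [d.αX, d.βX]; simp
  | succ n ih =>
    obtain ⟨f, hf, hv⟩ := ih
    refine ⟨ext d _ f, ext_good d _ f hf, ?_⟩
    change ext d _ f (TensorProduct.tmul k (vec d n) d.X) = _
    have h1 : (tensorPow M n).ρ g⁻¹ (vec d n) = vec d n := by
      conv_lhs => rw [← (vec_fixed d n).1]
      rw [rho_mul]; simp
    simp only [ext, TensorProduct.lift.tmul, LinearMap.mk₂_apply, d.αX, d.βX, h1, hv]
    simp only [one_smul, zero_smul, add_zero]
    ring

open Polynomial in
theorem not_algebraic {g h : G} {M : FDRep k G} (d : Data g h M) : ¬ IsAlgebraic M := by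
  rintro ⟨L, hL⟩
  obtain ⟨D, hD⟩ := exists_stat_list g h L
  have hst : Stat g h D (tensorPow M D) := by
    refine stat_of_indecomposable g h D _ _ rfl fun A hA hAM => ?_
    obtain ⟨N', hN', ⟨e⟩⟩ := hL A hA ⟨D, hAM⟩
    exact (hD N' hN').of_iso e
  have h1 := hst (D + 2) _ (filt_anti g h _ (Nat.le_succ D) (vec_mem d D))
  obtain ⟨f, hf, hv⟩ := exists_good d D
  have h2 := hf.dvd h1
  rw [hv, neg_pow, (isUnit_one.neg.pow (D + 1)).dvd_mul_left] at h2
  have := (pow_dvd_pow_iff (X_ne_zero (R := k)) not_isUnit_X).1 h2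
  omega

end General

/-! ## The module `kP / J^2` -/

section Special

variable (p : ℕ) [Fact p.Prime]

/-- The dual-number-like algebra `k[x,y]/(x,y)^2`. -/
abbrev T := TrivSqZeroExt (ZMod p) (ZMod p × ZMod p)

/-- The homomorphism `P → (k[x,y]/(x,y)^2)^*`. -/
def grpHom : Pgrp p →* T p where
  toFun g := 1 + TrivSqZeroExt.inr g.toAdd
  map_one' := by simp
  map_mul' a b := by
    rw [toAdd_mul, TrivSqZeroExt.inr_add, add_mul, mul_add, mul_add, TrivSqZeroExt.inr_mul_inr]
    rw [mul_one, one_mul, mul_one, add_zero]; abel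

/-- The algebra map `kP → k[x,y]/(x,y)^2`. -/
noncomputable def algHom : GrpAlg p →ₐ[ZMod p] T p := MonoidAlgebra.lift _ _ _ (grpHom p)

/-- The augmentation. -/
noncomputable def aug : GrpAlg p →ₐ[ZMod p] ZMod p :=
  (TrivSqZeroExt.fstHom (ZMod p) (ZMod p) (ZMod p × ZMod p)).comp (algHom p)

lemma algHom_of (g : Pgrp p) : algHom p (MonoidAlgebra.of _ _ g) =
    1 + TrivSqZeroExt.inr g.toAdd := by
  simp [algHom, grpHom]

lemma aug_of (g : Pgrp p) : aug p (MonoidAlgebra.of _ _ g) = 1 := by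
  rw [aug, AlgHom.comp_apply, algHom_of]; simp

lemma Jrad_le : Jrad p ≤ RingHom.ker (aug p) := by
  have hs : Function.Surjective (aug p) := fun c => ⟨algebraMap _ _ c, AlgHom.commutes (aug p) c⟩
  have : (RingHom.ker (aug p)).IsMaximal := RingHom.ker_isMaximal_of_surjective _ hs
  exact sInf_le ⟨bot_le, this⟩

lemma le_Jrad (z : GrpAlg p) (hz : aug p z = 0) : z ∈ Jrad p := by
  have hzp : ∀ z : GrpAlg p, z ^ p = algebraMap (ZMod p) _ (aug p z) := by
    intro z
    have : CharP (GrpAlg p) p := charP_of_injective_algebraMap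
      (algebraMap (ZMod p) (GrpAlg p)).injective p
    induction z using MonoidAlgebra.induction_linear with
    | zero => rw [map_zero, map_zero, zero_pow (Fact.out : p.Prime).ne_zero]
    | add a b ha hb => rw [add_pow_char, ha, hb, map_add, map_add]
    | single g c =>
      have h2 : (MonoidAlgebra.single g c : GrpAlg p) =
        algebraMap (ZMod p) _ c * MonoidAlgebra.of (ZMod p) (Pgrp p) g := by simp
      have h3 : g ^ p = 1 := by
        apply Multiplicative.toAdd.injective
        rw [toAdd_pow, toAdd_one]
        ext <;> simp
      rw [h2, mul_pow, ← map_pow, ← map_pow, h3, map_one, ZMod.pow_card, map_mul, aug_of,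
        AlgHom.commutes]
      simp
  have hn : IsNilpotent z := ⟨p, by rw [hzp, hz, map_zero]⟩
  rw [Jrad, Ideal.mem_jacobson_bot]
  intro y
  exact (Commute.all z y |>.isNilpotent_mul_right hn).isUnit_add_one

lemma algHom_sq (z : GrpAlg p) (hz : z ∈ Jrad p ^ 2) : algHom p z = 0 := by
  rw [pow_two] at hz
  have hJ : ∀ a ∈ Jrad p, (algHom p a).fst = 0 := fun a ha => Jrad_le p ha
  refine Submodule.mul_induction_on hz (fun a ha b hb => ?_) (fun a b ha hb => ?_)
  · rw [map_mul]
    ext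
    · simp [hJ a ha]
    · simp [hJ a ha, hJ b hb]
    · simp [hJ a ha, hJ b hb]
  · rw [map_add, ha, hb, add_zero]

abbrev Q := GrpAlg p ⧸ (Jrad p ^ 2)

/-- The induced map on `kP / J^2`. -/
noncomputable def qHom : Q p →ₐ[ZMod p] T p :=
  Ideal.Quotient.liftₐ _ (algHom p) (algHom_sq p)

/-- The class of a group element. -/
noncomputable def cls (g : Pgrp p) : Q p :=
  Ideal.Quotient.mk (Jrad p ^ 2) (MonoidAlgebra.of (ZMod p) (Pgrp p) g)

lemma qHom_cls (g : Pgrp p) : qHom p (cls p g) = 1 + TrivSqZeroExt.inr g.toAdd :=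
  algHom_of p g

lemma cls_mul (a b : Pgrp p) : cls p (a * b) = cls p a * cls p b := by
  simp only [cls, map_mul]

lemma cls_one : cls p 1 = 1 := by
  simp only [cls, map_one]

lemma cls_sub_mul (a b : Pgrp p) : (cls p a - 1) * (cls p b - 1) = 0 := by
  have h : ∀ a, MonoidAlgebra.of (ZMod p) (Pgrp p) a - 1 ∈ Jrad p := fun a =>
    le_Jrad p _ (by rw [map_sub, aug_of, map_one, sub_self])
  have := Ideal.mul_mem_mul (h a) (h b)
  rw [← pow_two] at this
  have := Ideal.Quotient.eq_zero_iff_mem.2 this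
  rw [map_mul, map_sub, map_sub, map_one] at this
  exact this

/-- `g ↦ g - 1` is additive modulo `J^2`. -/
noncomputable def dlog : ZMod p × ZMod p →+ Q p where
  toFun a := cls p (Multiplicative.ofAdd a) - 1
  map_zero' := by rw [ofAdd_zero, cls_one, sub_self]
  map_add' a b := by
    have := cls_sub_mul p (Multiplicative.ofAdd a) (Multiplicative.ofAdd b)
    rw [ofAdd_add, cls_mul]
    linear_combination this

lemma finrank_T : Module.finrank (ZMod p) (T p) = 3 := by
  have : Module.finrank (ZMod p) (ZMod p × (ZMod p × ZMod p)) = 3 := by simp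
  exact this

/-- The inverse linear map. -/
noncomputable def invT : (ZMod p × (ZMod p × ZMod p)) →ₗ[ZMod p] Q p :=
  LinearMap.coprod (Algebra.linearMap (ZMod p) (Q p)) ((dlog p).toZModLinearMap p)

lemma invT_surj : Function.Surjective (invT p) := by
  rw [← LinearMap.range_eq_top, eq_top_iff]
  rintro q -
  obtain ⟨z, rfl⟩ := Ideal.Quotient.mk_surjective q
  induction z using MonoidAlgebra.induction_linear with
  | zero => simp
  | add a b ha hb => rw [map_add]; exact Submodule.add_mem _ ha hb
  | single g c =>
    refine ⟨c • (1, g.toAdd), ?_⟩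
    rw [map_smul]
    have h1 : invT p (1, g.toAdd) = cls p g := by
      simp [invT, dlog]
    rw [h1]
    have h2 : (MonoidAlgebra.single g c : GrpAlg p) = c • MonoidAlgebra.of (ZMod p) (Pgrp p) g := by
      simp
    rw [h2]; rfl

lemma qHom_invT (z : ZMod p × (ZMod p × ZMod p)) :
    qHom p (invT p z) = TrivSqZeroExt.inl z.1 + TrivSqZeroExt.inr z.2 := by
  have h : qHom p (dlog p z.2) = TrivSqZeroExt.inr z.2 := by
    change qHom p (cls p (Multiplicative.ofAdd z.2) - 1) = _
    rw [map_sub, qHom_cls, map_one, add_sub_cancel_left]; rfl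
  have h' : invT p z = algebraMap _ _ z.1 + dlog p z.2 := rfl
  rw [h', map_add, h, AlgHom.commutes]; rfl

lemma invT_inj : Function.Injective (invT p) := by
  intro a b hab
  have := congrArg (qHom p) hab
  rw [qHom_invT, qHom_invT] at this
  have h1 := congrArg TrivSqZeroExt.fst this
  have h2 := congrArg TrivSqZeroExt.snd this
  simp at h1 h2
  exact Prod.ext h1 h2

lemma finrank_Q : Module.finrank (ZMod p) (Q p) = 3 := by
  rw [← (LinearEquiv.ofBijective (invT p) ⟨invT_inj p, invT_surj p⟩).finrank_eq]
  simp

/-- First generator. -/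
def gg : Pgrp p := Multiplicative.ofAdd (1, 0)
/-- Second generator. -/
def hh : Pgrp p := Multiplicative.ofAdd (0, 1)

/-- The second component of `qHom`. -/
noncomputable def sndQ : Q p →ₗ[ZMod p] ZMod p × ZMod p :=
  (TrivSqZeroExt.sndHom (ZMod p) (ZMod p × ZMod p)) ∘ₗ (qHom p).toLinearMap

/-- The first component of `qHom`. -/
noncomputable def fstQ : Q p →ₗ[ZMod p] ZMod p :=
  (TrivSqZeroExt.fstHom (ZMod p) (ZMod p) (ZMod p × ZMod p)).toLinearMap ∘ₗ (qHom p).toLinearMap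

lemma sndQ_mul (g : Pgrp p) (m : Q p) :
    sndQ p (cls p g * m) = sndQ p m + fstQ p m • g.toAdd := by
  change (qHom p (cls p g * m)).snd = (qHom p m).snd + (qHom p m).fst • g.toAdd
  rw [map_mul, qHom_cls]
  simp

lemma sndQ_cls (g : Pgrp p) : sndQ p (cls p g - 1) = g.toAdd := by
  change (qHom p (cls p g - 1)).snd = _
  rw [map_sub, qHom_cls, map_one, add_sub_cancel_left]; rfl

lemma cls_fix (a b : Pgrp p) : cls p a * (cls p b - 1) = cls p b - 1 := by
  linear_combination cls_sub_mul p a b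

noncomputable def theData : Data (gg p) (hh p) (FDRep.of (radQuotRep p 2)) where
  one := (1 : Q p)
  X := (cls p (gg p) - 1 : Q p)
  Y := (cls p (hh p) - 1 : Q p)
  α := LinearMap.fst _ _ _ ∘ₗ sndQ p
  β := LinearMap.snd _ _ _ ∘ₗ sndQ p
  ε := fstQ p
  g_one := show cls p (gg p) * (1 : Q p) = 1 + (cls p (gg p) - 1) by ring
  h_one := show cls p (hh p) * (1 : Q p) = 1 + (cls p (hh p) - 1) by ring
  gX := cls_fix p _ _
  hX := cls_fix p _ _
  gY := cls_fix p _ _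
  hY := cls_fix p _ _
  αX := show (sndQ p (cls p (gg p) - 1)).1 = 1 by rw [sndQ_cls]; rfl
  βX := show (sndQ p (cls p (gg p) - 1)).2 = 0 by rw [sndQ_cls]; rfl
  αg m := show (sndQ p (cls p (gg p) * m)).1 = (sndQ p m).1 + fstQ p m by
    rw [sndQ_mul]; simp [gg]
  αh m := show (sndQ p (cls p (hh p) * m)).1 = (sndQ p m).1 by
    rw [sndQ_mul]; simp [hh]
  βg m := show (sndQ p (cls p (gg p) * m)).2 = (sndQ p m).2 by
    rw [sndQ_mul]; simp [gg]
  βh m := show (sndQ p (cls p (hh p) * m)).2 = (sndQ p m).2 + fstQ p m by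
    rw [sndQ_mul]; simp [hh]

end Special

end RQ

/-- For `P = C_p × C_p` and `k = F_p`, the module `M_2 = kP ⧸ J^2` is a `3`-dimensional
non-algebraic `kP`-module. -/
theorem radical_quotient_nonalgebraic (p : ℕ) [Fact p.Prime] :
    Module.finrank (ZMod p) (GrpAlg p ⧸ (Jrad p ^ 2)) = 3 ∧
      ¬ IsAlgebraic (FDRep.of (radQuotRep p 2)) := by
  exact ⟨RQ.finrank_Q p, RQ.not_algebraic (RQ.theData p)⟩
end

section
/- Let k be a field of characteristic 2 and let G = Alt(8) be the alternating group on 8 letters, acting on k^8 by permuting coordinates. Let U = { v ∈ k^8 : the sum of the coordinates of v is 0 } and let W be the span of the all-ones vector (note W ⊆ U since the characteristic is 2). Then the 6-dimensional kG-module M = U/W (the natural module for Alt(8) viewed as Ω_6^+(2)) is non-algebraic. -/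
open CategoryTheory CategoryTheory.MonoidalCategory

open AlgebraicModule

/-- The sum-of-coordinates linear functional on `k^n`. -/
def sumCoords (k : Type) [Field k] (n : ℕ) : (Fin n → k) →ₗ[k] k where
  toFun v := ∑ i, v i
  map_add' u v := by simp [Finset.sum_add_distrib]
  map_smul' c v := by simp [Finset.mul_sum]

/-- `U`: the vectors in `k^n` whose coordinates sum to zero. -/
def Uzero (k : Type) [Field k] (n : ℕ) : Submodule k (Fin n → k) :=
  LinearMap.ker (sumCoords k n)

/-- `W`: the span of the all-ones vector in `k^n`. -/
def Wone (k : Type) [Field k] (n : ℕ) : Submodule k (Fin n → k) :=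
  Submodule.span k {fun _ => (1 : k)}

/-- `W` viewed as a submodule of `U`. -/
def Wone' (k : Type) [Field k] (n : ℕ) : Submodule k (Uzero k n) :=
  (Wone k n).comap (Uzero k n).subtype

/-- The quotient module `U / W`. -/
abbrev UmodW (k : Type) [Field k] (n : ℕ) := Uzero k n ⧸ Wone' k n

/-- The linear map on `k^n` permuting coordinates according to `σ`. -/
def permMap (k : Type) [Field k] (n : ℕ) (σ : Equiv.Perm (Fin n)) :
    (Fin n → k) →ₗ[k] (Fin n → k) where
  toFun v := fun i => v (σ⁻¹ i)
  map_add' u v := rfl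
  map_smul' c v := rfl

lemma permMap_mem_U (k : Type) [Field k] (n : ℕ) (σ : Equiv.Perm (Fin n)) (v : Fin n → k)
    (hv : v ∈ Uzero k n) : permMap k n σ v ∈ Uzero k n := by
  exact LinearMap.mem_ker.2 ((Equiv.sum_comp σ⁻¹ v).trans (LinearMap.mem_ker.1 hv))

lemma permMap_mem_W (k : Type) [Field k] (n : ℕ) (σ : Equiv.Perm (Fin n)) (v : Fin n → k)
    (hv : v ∈ Wone k n) : permMap k n σ v ∈ Wone k n := by
  rw [Wone, Submodule.mem_span_singleton] at hv ⊢
  obtain ⟨c, rfl⟩ := hv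
  exact ⟨c, rfl⟩

/-- The permutation map restricted to `U`. -/
def permMapU (k : Type) [Field k] (n : ℕ) (σ : Equiv.Perm (Fin n)) :
    Uzero k n →ₗ[k] Uzero k n :=
  (permMap k n σ).restrict (fun v hv => permMap_mem_U k n σ v hv)

lemma permMapU_mem (k : Type) [Field k] (n : ℕ) (σ : Equiv.Perm (Fin n)) :
    Wone' k n ≤ (Wone' k n).comap (permMapU k n σ) := by
  intro x hx
  exact permMap_mem_W k n σ x.1 hx

/-- The induced map on the quotient `U / W`. -/
def permMapQ (k : Type) [Field k] (n : ℕ) (σ : Equiv.Perm (Fin n)) :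
    UmodW k n →ₗ[k] UmodW k n :=
  Submodule.mapQ (Wone' k n) (Wone' k n) (permMapU k n σ) (permMapU_mem k n σ)

lemma permMapQ_mul (k : Type) [Field k] (n : ℕ) (σ τ : Equiv.Perm (Fin n)) :
    permMapQ k n (σ * τ) = (permMapQ k n σ).comp (permMapQ k n τ) := by
  apply Submodule.linearMap_qext
  ext x
  simp only [LinearMap.comp_apply, Submodule.mkQ_apply, permMapQ, Submodule.mapQ_apply]
  congr 1

lemma permMapQ_one (k : Type) [Field k] (n : ℕ) : permMapQ k n 1 = LinearMap.id := by
  apply Submodule.linearMap_qext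
  ext x
  simp only [LinearMap.comp_apply, Submodule.mkQ_apply, permMapQ, Submodule.mapQ_apply,
    LinearMap.id_apply]
  congr 1

/-- The representation of the alternating group `Alt(n)` on `U / W`, induced by permuting
coordinates of `k^n`. -/
def altQuotRep (k : Type) [Field k] (n : ℕ) :
    Representation k (alternatingGroup (Fin n)) (UmodW k n) where
  toFun σ := permMapQ k n (σ : Equiv.Perm (Fin n))
  map_one' := permMapQ_one k n
  map_mul' σ τ := permMapQ_mul k n σ τ

open scoped TensorProduct

namespace Alt8Aux

section linear
variable {k : Type} [Field k] {V V' : Type} [AddCommGroup V] [Module k V]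
  [AddCommGroup V'] [Module k V']

/-- The increasing chain of subspaces `S_0 = 0`, `S_{n+1} = (A-1)⁻¹ (B-1) S_n`. -/
def chain (A B : V →ₗ[k] V) : ℕ → Submodule k V
  | 0 => ⊥
  | n + 1 => ((chain A B n).map (B - 1)).comap (A - 1)

lemma mem_chain_succ (A B : V →ₗ[k] V) (n : ℕ) (v : V) :
    v ∈ chain A B (n + 1) ↔ ∃ u ∈ chain A B n, B u - u = A v - v := by
  simp [chain]

lemma chain_mono (A B : V →ₗ[k] V) (n : ℕ) : chain A B n ≤ chain A B (n + 1) := by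
  induction n with
  | zero => simp [chain]
  | succ n ih =>
    intro v hv
    rw [mem_chain_succ] at hv ⊢
    obtain ⟨u, hu, h⟩ := hv
    exact ⟨u, ih hu, h⟩

lemma chain_stable (A B : V →ₗ[k] V) (n : ℕ) (h : chain A B n = chain A B (n + 1)) (j : ℕ) :
    chain A B (n + j) = chain A B (n + j + 1) := by
  induction j with
  | zero => exact h
  | succ j ih =>
    change ((chain A B (n + j)).map (B - 1)).comap (A - 1) =
      ((chain A B (n + j + 1)).map (B - 1)).comap (A - 1)
    rw [ih]

lemma chain_finrank [FiniteDimensional k V] (A B : V →ₗ[k] V) (n : ℕ)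
    (h : chain A B n ≠ chain A B (n + 1)) :
    ∀ j ≤ n + 1, j ≤ Module.finrank k (chain A B j) := by
  intro j
  induction j with
  | zero => simp
  | succ j ih =>
    intro hj
    have h1 := ih (by omega)
    have h2 : chain A B j < chain A B (j + 1) := by
      refine lt_of_le_of_ne (chain_mono A B j) fun he => h ?_
      have := chain_stable A B j he (n - j)
      rwa [show j + (n - j) = n by omega] at this
    have := Submodule.finrank_lt_finrank_of_lt h2
    omega

lemma chain_map (A B : V →ₗ[k] V) (A' B' : V' →ₗ[k] V') (f : V →ₗ[k] V')
    (hA : ∀ v, f (A v) = A' (f v)) (hB : ∀ v, f (B v) = B' (f v)) (n : ℕ) :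
    ∀ v ∈ chain A B n, f v ∈ chain A' B' n := by
  induction n with
  | zero => intro v hv; simp_all [chain]
  | succ n ih =>
    intro v hv
    rw [mem_chain_succ] at hv ⊢
    obtain ⟨u, hu, h⟩ := hv
    refine ⟨f u, ih u hu, ?_⟩
    rw [← hA, ← hB, ← map_sub, ← map_sub, h]

variable (k) in
/-- The infinite zigzag module. -/
abbrev Zig := (ℕ → k) × (ℕ → k)

variable (k) in
/-- Action of the first generator on the zigzag module. -/
def zA : Zig k →ₗ[k] Zig k where
  toFun z := (z.1, fun i => z.2 i + if i = 0 then 0 else z.1 i)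
  map_add' u v := by
    ext i
    · simp
    · by_cases h : i = 0 <;> simp [h]
      ring
  map_smul' c v := by
    ext i
    · simp
    · by_cases h : i = 0 <;> simp [h]
      ring

/-- Shift of a sequence. -/
def shift (p : ℕ → k) : ℕ → k
  | 0 => 0
  | i + 1 => p i

variable (k) in
/-- Action of the second generator on the zigzag module. -/
def zB (n : ℕ) : Zig k →ₗ[k] Zig k where
  toFun z := (z.1, fun i => z.2 i + if i ≤ n then shift z.1 i else 0)
  map_add' u v := by
    ext i
    · simp
    · by_cases h : i ≤ n <;> cases i <;> simp [shift, h]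
      ring
  map_smul' c v := by
    ext i
    · simp
    · by_cases h : i ≤ n <;> cases i <;> simp [shift, h]
      ring

variable (k) in
/-- The operator attached to `X`. -/
def fX : Zig k →ₗ[k] Zig k where
  toFun z := (fun i => if i = 0 then z.1 0 else 0, 0)
  map_add' u v := by ext i <;> simp; split_ifs <;> simp
  map_smul' c v := by ext i <;> simp

variable (k) in
/-- The operator attached to `Y`. -/
def fY : Zig k →ₗ[k] Zig k where
  toFun z := (shift z.1, shift z.2)
  map_add' u v := by ext i <;> cases i <;> simp [shift]
  map_smul' c v := by ext i <;> cases i <;> simp [shift]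

variable (k) in
/-- The operator attached to `Z`. -/
def fZ : Zig k →ₗ[k] Zig k where
  toFun z := (0, fun i => if i = 1 then z.1 0 else 0)
  map_add' u v := by ext i <;> simp; split_ifs <;> simp
  map_smul' c v := by ext i <;> simp

lemma zig_chain (m n : ℕ) : ∀ z ∈ chain (zA k) (zB k m) n, ∀ j, n ≤ j → z.1 j = 0 := by
  induction n with
  | zero => intro z hz; simp_all [chain]
  | succ n ih =>
    intro z hz j hj
    rw [mem_chain_succ] at hz
    obtain ⟨u, hu, h⟩ := hz
    obtain ⟨j, rfl⟩ : ∃ i, j = i + 1 := ⟨j - 1, by omega⟩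
    have h1 := congrFun (congrArg Prod.snd h) (j + 1)
    have h2 := ih u hu j (by omega)
    simp [zA, zB, shift, h2] at h1
    exact h1.symm

/-- A witness that the chain does not stabilise before step `n`. -/
def Witness (A B : V →ₗ[k] V) (n : ℕ) : Prop :=
  ∃ (v : ℕ → V) (φ : V →ₗ[k] Zig k), A (v 0) = v 0 ∧
    (∀ i, A (v (i + 1)) = v (i + 1) + (v i + B (v i))) ∧
    (∀ u, φ (A u) = zA k (φ u)) ∧ (∀ u, φ (B u) = zB k n (φ u)) ∧ (φ (v n)).1 n = 1

lemma add_self_two [CharP k 2] (v : V) : v + v = 0 := by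
  have : (2 : k) • v = 0 := by rw [CharTwo.two_eq_zero, zero_smul]
  rwa [two_smul] at this

lemma Witness.chain_ne [CharP k 2] {A B : V →ₗ[k] V} {n : ℕ} (h : Witness A B n) :
    ∃ v ∈ chain A B (n + 1), v ∉ chain A B n := by
  obtain ⟨v, φ, h0, h1, hA, hB, hn⟩ := h
  have key : ∀ i, v i ∈ chain A B (i + 1) := by
    intro i
    induction i with
    | zero => rw [mem_chain_succ]; exact ⟨0, by simp [chain], by simp [h0]⟩
    | succ i ih =>
      rw [mem_chain_succ]
      refine ⟨v i, ih, ?_⟩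
      rw [h1]
      have := add_self_two (k := k) (v i)
      rw [add_sub_cancel_left, sub_eq_iff_eq_add, add_comm (v i), add_assoc, this, add_zero]
  refine ⟨v n, key n, fun hc => ?_⟩
  have := zig_chain n n _ (chain_map A B _ _ φ hA hB n _ hc) n le_rfl
  rw [hn] at this
  exact one_ne_zero this

/-- The data on `M` used for the induction. -/
structure Data (A B : V →ₗ[k] V) where
  X : V
  Y : V
  α : V →ₗ[k] k
  β : V →ₗ[k] k
  γ : V →ₗ[k] k
  AX : A X = X
  AY : A Y = Y + (X + B X)
  BY : B Y = Y
  αA : ∀ v, α (A v) = α v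
  αB : ∀ v, α (B v) = α v
  βA : ∀ v, β (A v) = β v
  βB : ∀ v, β (B v) = β v
  γA : ∀ v, γ (A v) = γ v + β v
  γB : ∀ v, γ (B v) = γ v + α v
  αX : α X = 1
  αY : α Y = 0
  βX : β X = 0
  βY : β Y = 1

/-- The bilinear map `Zig × M → Zig`. -/
noncomputable def Data.act {A B : V →ₗ[k] V} (d : Data A B) : Zig k →ₗ[k] V →ₗ[k] Zig k :=
  LinearMap.flip (d.α.smulRight (fX k) + d.β.smulRight (fY k) + d.γ.smulRight (fZ k))

lemma Data.act_apply {A B : V →ₗ[k] V} (d : Data A B) (z : Zig k) (v : V) :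
    d.act z v = d.α v • fX k z + d.β v • fY k z + d.γ v • fZ k z := by
  simp [Data.act]

lemma Data.act_A [CharP k 2] {A B : V →ₗ[k] V} (d : Data A B) (z : Zig k) (v : V) :
    d.act (zA k z) (A v) = zA k (d.act z v) := by
  have h2 : (2 : k) = 0 := CharTwo.two_eq_zero
  simp only [d.act_apply, d.αA, d.βA, d.γA]
  ext i
  · rcases i with _ | i <;> simp [zA, fX, fY, fZ, shift]
  · rcases i with _ | _ | i <;> simp [zA, fX, fY, fZ, shift]
    all_goals ring

lemma Data.act_B [CharP k 2] {A B : V →ₗ[k] V} (d : Data A B) (n : ℕ) (z : Zig k)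
    (v : V) : d.act (zB k n z) (B v) = zB k (n + 1) (d.act z v) := by
  have h2 : (2 : k) = 0 := CharTwo.two_eq_zero
  simp only [d.act_apply, d.αB, d.βB, d.γB]
  ext i
  · rcases i with _ | i <;> simp [zB, fX, fY, fZ, shift]
  · rcases i with _ | _ | i <;> simp [zB, fX, fY, fZ, shift]
    · ring
    · split_ifs <;> ring

/-- The vector `v_0` of the zigzag module. -/
def z0 : Zig k := (fun i => if i = 0 then 1 else 0, 0)

lemma witness_base [CharP k 2] {A B : V →ₗ[k] V} (d : Data A B) : Witness A B 1 := by
  refine ⟨fun i => match i with | 0 => d.X | 1 => d.Y | _ + 2 => 0, d.act z0, d.AX, ?_, ?_, ?_, ?_⟩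
  · rintro (_ | _ | i)
    · exact d.AY
    · have := add_self_two (k := k) d.Y
      simp [d.BY, this]
    · simp
  · intro u
    rw [← d.act_A]
    congr 2
    ext i <;> simp [z0, zA]
  · intro u
    rw [← d.act_B 0]
    congr 2
    ext i
    · simp [z0, zB]
    · rcases i with _ | i <;> simp [z0, zB, shift]
  · simp [d.act_apply, d.αY, d.βY, fX, fY, fZ, shift, z0]

lemma witness_step [CharP k 2] {A B : V →ₗ[k] V} (d : Data A B) {A' B' : V' →ₗ[k] V'}
    (hAB : ∀ u, A' (B' u) = B' (A' u)) (hBB : ∀ u, B' (B' u) = u) {n : ℕ}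
    (h : Witness A' B' n) :
    Witness (TensorProduct.map A' A) (TensorProduct.map B' B) (n + 1) := by
  obtain ⟨v, φ, h0, h1, hA, hB, hn⟩ := h
  refine ⟨fun i => match i with
    | 0 => B' (v 0) ⊗ₜ d.X
    | i + 1 => B' (v (i + 1)) ⊗ₜ d.X + v i ⊗ₜ d.Y + (v i + B' (v i)) ⊗ₜ d.X,
    TensorProduct.lift (d.act ∘ₗ φ), ?_, ?_, ?_, ?_, ?_⟩
  · simp [hAB, h0, d.AX]
  · have h2 : ∀ t : V' ⊗[k] V, t + t = 0 := add_self_two (k := k)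
    rintro (_ | i)
    · simp only [map_add, TensorProduct.map_tmul, hAB, h0, h1, d.AX, d.AY, d.BY, hBB,
        TensorProduct.add_tmul, TensorProduct.tmul_add]
      linear_combination (norm := module) h2 (v 0 ⊗ₜ d.X)
    · simp only [map_add, TensorProduct.map_tmul, hAB, h0, h1, d.AX, d.AY, d.BY, hBB,
        TensorProduct.add_tmul, TensorProduct.tmul_add]
      linear_combination (norm := module) h2 (v (i + 1) ⊗ₜ d.X) + h2 (v i ⊗ₜ d.X) + h2 (B' (v i) ⊗ₜ d.X)
  · intro u
    induction u with
    | zero => simp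
    | add a b ha hb => simp only [map_add, ha, hb]
    | tmul a b => simp [hA, d.act_A]
  · intro u
    induction u with
    | zero => simp
    | add a b ha hb => simp only [map_add, ha, hb]
    | tmul a b => simp [hB, d.act_B]
  · simp [d.act_apply, d.αX, d.αY, d.βX, d.βY, fX, fY, fZ, shift, hn]

end linear

section cat
variable {k G : Type} [Field k] [Group G]

lemma hom_comm {N N' : FDRep k G} (f : N ⟶ N') (g : G) (v : N) :
    f.hom.hom.hom (N.ρ g v) = N'.ρ g (f.hom.hom.hom v) := by
  have := f.comm g
  exact ConcreteCategory.congr_hom this v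

lemma tensorPow_ρ (M : FDRep k G) (n : ℕ) (g : G) :
    (tensorPow M (n + 1)).ρ g = TensorProduct.map ((tensorPow M n).ρ g) (M.ρ g) := rfl

lemma ρ_comm (N : FDRep k G) (a b : G) (hab : a * b = b * a) (u : N) :
    N.ρ a (N.ρ b u) = N.ρ b (N.ρ a u) := by
  rw [← Module.End.mul_apply, ← map_mul, hab, map_mul, Module.End.mul_apply]

lemma ρ_sq (N : FDRep k G) (b : G) (hbb : b * b = 1) (u : N) : N.ρ b (N.ρ b u) = u := by
  rw [← Module.End.mul_apply, ← map_mul, hbb, map_one, Module.End.one_apply]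

lemma tensorPow_witness [CharP k 2] (M : FDRep k G) (a b : G) (hab : a * b = b * a)
    (hbb : b * b = 1) (d : Data (M.ρ a) (M.ρ b)) (n : ℕ) :
    Witness ((tensorPow M n).ρ a) ((tensorPow M n).ρ b) (n + 1) := by
  induction n with
  | zero => exact witness_base d
  | succ n ih =>
    refine witness_step d ?_ ?_ ih
    · exact fun u => ρ_comm _ a b hab u
    · exact fun u => ρ_sq _ b hbb u

instance : IsIdempotentComplete (FDRep k G) :=
  (Idempotents.isIdempotentComplete_iff_idempotents_have_kernels _).2
    (fun _ _ _ => inferInstance)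

/-- The chain of `N` grows at step `n`. -/
def Grows (a b : G) (n : ℕ) (N : FDRep k G) : Prop :=
  ∃ v ∈ chain (N.ρ a) (N.ρ b) (n + 1), v ∉ chain (N.ρ a) (N.ρ b) n

lemma Grows.finrank {a b : G} {n : ℕ} {N : FDRep k G} (h : Grows a b n N) :
    n + 1 ≤ Module.finrank k N := by
  obtain ⟨v, hv, hv'⟩ := h
  have := chain_finrank (N.ρ a) (N.ρ b) n (fun h => hv' (h ▸ hv)) (n + 1) le_rfl
  exact this.trans (Submodule.finrank_le _)

lemma retract_finrank_lt {N Y : FDRep k G} (i : Y ⟶ N) (p : N ⟶ Y) (h : i ≫ p = 𝟙 Y)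
    (hne : p ≫ i ≠ 𝟙 N) : Module.finrank k Y < Module.finrank k N := by
  have hpi : ∀ y : Y, p.hom.hom.hom (i.hom.hom.hom y) = y := fun y =>
    congrArg (fun f : Y ⟶ Y => f.hom.hom.hom y) h
  have hinj : Function.Injective i.hom.hom.hom := fun x y hxy => by
    rw [← hpi x, ← hpi y, hxy]
  by_contra hlt
  have hle := LinearMap.finrank_le_finrank_of_injective hinj
  have hsurj := (LinearMap.injective_iff_surjective_of_finrank_eq_finrank
    (f := i.hom.hom.hom) (le_antisymm hle (not_lt.1 hlt))).1 hinj
  apply hne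
  ext v
  obtain ⟨y, rfl⟩ := hsurj v
  exact congrArg i.hom.hom.hom (hpi y)

lemma grows_of_split {a b : G} {n : ℕ} {N Y : FDRep k G} (i : Y ⟶ N) (p : N ⟶ Y) (v : N)
    (hv : v ∈ chain (N.ρ a) (N.ρ b) (n + 1))
    (hv' : (p ≫ i).hom.hom.hom v ∉ chain (N.ρ a) (N.ρ b) n) : Grows a b n Y := by
  refine ⟨p.hom.hom.hom v, chain_map _ _ _ _ _ (hom_comm p a) (hom_comm p b) _ _ hv, fun hc => ?_⟩
  exact hv' (chain_map _ _ _ _ _ (hom_comm i a) (hom_comm i b) _ _ hc)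

lemma exists_indec (a b : G) (n : ℕ) (T : FDRep k G) (D : ℕ) :
    ∀ N : FDRep k G, Module.finrank k N = D → IsSummand N T → Grows a b n N →
      ∃ N' : FDRep k G, AlgebraicModule.Indecomposable N' ∧ IsSummand N' T ∧ Grows a b n N' := by
  induction D using Nat.strong_induction_on with
  | _ D ih =>
  intro N hD hs hg
  have hstep : ∀ (Y : FDRep k G) (i : Y ⟶ N) (p : N ⟶ Y), i ≫ p = 𝟙 Y → p ≫ i ≠ 𝟙 N →
      Grows a b n Y → ∃ N' : FDRep k G, AlgebraicModule.Indecomposable N' ∧ IsSummand N' T ∧ Grows a b n N' := by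
    intro Y i p h1 h2 h3
    refine ih _ (hD ▸ retract_finrank_lt i p h1 h2) Y rfl ?_ h3
    obtain ⟨j, q, hjq⟩ := hs
    exact ⟨i ≫ j, q ≫ p, by simp [reassoc_of% hjq, h1]⟩
  by_cases hN : AlgebraicModule.Indecomposable N
  · exact ⟨N, hN, hs, hg⟩
  by_cases hz : Limits.IsZero N
  · exfalso
    obtain ⟨v, hv, hv'⟩ := hg
    apply hv'
    have h0 : v = 0 := congrArg (fun f : N ⟶ N => f.hom.hom.hom v) (hz.eq_of_src (𝟙 N) 0)
    rw [h0]
    exact Submodule.zero_mem _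
  obtain ⟨e, he, he0, he1⟩ : ∃ e : N ⟶ N, e ≫ e = e ∧ e ≠ 0 ∧ e ≠ 𝟙 N := by
    by_contra hcon
    push Not at hcon
    exact hN ⟨hz, fun e he => or_iff_not_imp_left.2 (hcon e he)⟩
  obtain ⟨Y, i, p, h1, h2⟩ := IsIdempotentComplete.idempotents_split N e he
  obtain ⟨Y', i', p', h1', h2'⟩ := IsIdempotentComplete.idempotents_split N (𝟙 N - e)
    (Idempotents.idem_of_id_sub_idem e he)
  obtain ⟨v, hv, hv'⟩ := hg
  by_cases hc : e.hom.hom.hom v ∈ chain (N.ρ a) (N.ρ b) n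
  · refine hstep Y' i' p' h1' ?_ (grows_of_split i' p' v hv ?_)
    · rw [h2']
      intro h
      exact he0 (by simpa using h)
    · rw [h2']
      intro h
      apply hv'
      have hadd : v = e.hom.hom.hom v + (𝟙 N - e : N ⟶ N).hom.hom.hom v := by
        change v = e.hom.hom.hom v + (v - e.hom.hom.hom v)
        abel
      rw [hadd]
      exact Submodule.add_mem _ hc h
  · exact hstep Y i p h1 (h2 ▸ he1) (grows_of_split i p v hv (h2 ▸ hc))

lemma not_algebraic [CharP k 2] (M : FDRep k G) (a b : G) (hab : a * b = b * a)
    (hbb : b * b = 1) (d : Data (M.ρ a) (M.ρ b)) : ¬ IsAlgebraic M := by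
  rintro ⟨L, hL⟩
  obtain ⟨D, hD⟩ : ∃ D, ∀ N ∈ L, Module.finrank k N ≤ D := by
    clear hL
    induction L with
    | nil => exact ⟨0, by simp⟩
    | cons N L ih =>
      obtain ⟨D, hD⟩ := ih
      refine ⟨max D (Module.finrank k N), fun N' hN' => ?_⟩
      rcases List.mem_cons.1 hN' with rfl | h
      · exact le_max_right _ _
      · exact (hD _ h).trans (le_max_left _ _)
  obtain ⟨N, hN, hs, hg⟩ := exists_indec a b (D + 1) (tensorPow M D) _ (tensorPow M D) rfl
    ⟨𝟙 _, 𝟙 _, by simp⟩ (tensorPow_witness M a b hab hbb d D).chain_ne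
  obtain ⟨N', hN', ⟨f⟩⟩ := hL N hN ⟨D, hs⟩
  have h1 := hg.finrank
  have h2 := hD N' hN'
  have h3 := (FDRep.isoToLinearEquiv f).finrank_eq
  omega

end cat

section alt8
variable (k : Type) [Field k]

lemma one_mem_U [CharP k 2] : Wone k 8 ≤ Uzero k 8 := by
  rw [Wone, Submodule.span_singleton_le_iff_mem, Uzero, LinearMap.mem_ker]
  have h2 : (2 : k) = 0 := CharTwo.two_eq_zero
  simp [sumCoords]
  linear_combination 4 * h2

lemma finrank_UmodW [CharP k 2] : Module.finrank k (UmodW k 8) = 6 := by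
  have hs : Function.Surjective (sumCoords k 8) := fun c =>
    ⟨Pi.single 0 c, by simp [sumCoords]⟩
  have h1 := LinearMap.finrank_range_add_finrank_ker (sumCoords k 8)
  rw [LinearMap.range_eq_top.2 hs, finrank_top] at h1
  have h2 : Module.finrank k (Wone' k 8) = 1 := by
    rw [Wone', (Submodule.comapSubtypeEquivOfLe (one_mem_U k)).finrank_eq, Wone]
    exact finrank_span_singleton (fun h => one_ne_zero (congrFun h 0))
  have h3 := Submodule.finrank_quotient_add_finrank (Wone' k 8)
  have h4 : Module.finrank k (Uzero k 8) = Module.finrank k (sumCoords k 8).ker := rfl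
  rw [Module.finrank_self, Module.finrank_fin_fun, ← h4] at h1
  have h5 : Module.finrank k (Uzero k 8) = 6 + 1 := by omega
  rw [h2, h5] at h3
  exact Nat.add_right_cancel h3

/-- First generator of the four-group. -/
def pa : alternatingGroup (Fin 8) :=
  ⟨Equiv.swap 0 1 * Equiv.swap 2 3 * Equiv.swap 4 5 * Equiv.swap 6 7,
    Equiv.Perm.mem_alternatingGroup.2 (by decide)⟩

/-- Second generator of the four-group. -/
def pb : alternatingGroup (Fin 8) :=
  ⟨Equiv.swap 0 2 * Equiv.swap 1 3 * Equiv.swap 4 6 * Equiv.swap 5 7,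
    Equiv.Perm.mem_alternatingGroup.2 (by decide)⟩

lemma pab : pa * pb = pb * pa := by decide

lemma pbb : pb * pb = 1 := by decide

lemma pa_inv : (⇑((pa : Equiv.Perm (Fin 8))⁻¹) : Fin 8 → Fin 8) = ![1, 0, 3, 2, 5, 4, 7, 6] := by
  decide

lemma pb_inv : (⇑((pb : Equiv.Perm (Fin 8))⁻¹) : Fin 8 → Fin 8) = ![2, 3, 0, 1, 6, 7, 4, 5] := by
  decide

/-- A functional on `U/W` from one on `k^8`. -/
def func (l : (Fin 8 → k) →ₗ[k] k) (h : l (fun _ => 1) = 0) : UmodW k 8 →ₗ[k] k :=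
  (Wone' k 8).liftQ (l ∘ₗ (Uzero k 8).subtype) (by
    intro v hv
    obtain ⟨c, hc⟩ := Submodule.mem_span_singleton.1 (show (v : Fin 8 → k) ∈ Wone k 8 from hv)
    rw [LinearMap.mem_ker, LinearMap.comp_apply, Submodule.subtype_apply, ← hc, map_smul, h,
      smul_zero])

lemma func_mk (l : (Fin 8 → k) →ₗ[k] k) (h : l (fun _ => 1) = 0) (v : Uzero k 8) :
    func k l h (Submodule.Quotient.mk v) = l v := rfl

lemma rep_mk (g : alternatingGroup (Fin 8)) (v : Uzero k 8) :
    altQuotRep k 8 g (Submodule.Quotient.mk v) =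
      Submodule.Quotient.mk (permMapU k 8 (g : Equiv.Perm (Fin 8)) v) := rfl

lemma permA (v : Uzero k 8) : (permMapU k 8 (pa : Equiv.Perm (Fin 8)) v : Fin 8 → k) =
    fun i => (v : Fin 8 → k) (![1, 0, 3, 2, 5, 4, 7, 6] i) := by
  rw [← pa_inv]; rfl

lemma permB (v : Uzero k 8) : (permMapU k 8 (pb : Equiv.Perm (Fin 8)) v : Fin 8 → k) =
    fun i => (v : Fin 8 → k) (![2, 3, 0, 1, 6, 7, 4, 5] i) := by
  rw [← pb_inv]; rfl

/-- Coordinate projection. -/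
abbrev pr (i : Fin 8) : (Fin 8 → k) →ₗ[k] k := LinearMap.proj i

lemma mem_U_sum (v : Uzero k 8) : v.1 0 + v.1 1 + v.1 2 + v.1 3 + v.1 4 + v.1 5 + v.1 6 + v.1 7 = 0 := by
  have h : sumCoords k 8 v.1 = 0 := v.2
  simpa [sumCoords, Fin.sum_univ_eight] using h

/-- The data for `U/W`. -/
noncomputable def data8 [CharP k 2] : Data (altQuotRep k 8 pa) (altQuotRep k 8 pb) :=
  have h2 : (2 : k) = 0 := CharTwo.two_eq_zero
  { X := Submodule.Quotient.mk ⟨![1, 1, 0, 0, 0, 0, 0, 0], by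
      simp [Uzero, sumCoords, Fin.sum_univ_eight]; linear_combination h2⟩
    Y := Submodule.Quotient.mk ⟨![1, 0, 1, 0, 0, 0, 0, 0], by
      simp [Uzero, sumCoords, Fin.sum_univ_eight]; linear_combination h2⟩
    α := func k (pr k 1 + pr k 5 + pr k 3 + pr k 7) (by simp; linear_combination 2 * h2)
    β := func k (pr k 2 + pr k 6 + pr k 3 + pr k 7) (by simp; linear_combination 2 * h2)
    γ := func k (pr k 3 + pr k 7) (by simp; linear_combination h2)
    AX := by
      rw [rep_mk]
      congr 1
      apply Subtype.ext
      rw [permA]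
      ext i
      fin_cases i <;> simp
    AY := by
      rw [rep_mk, rep_mk, ← Submodule.Quotient.mk_add, ← Submodule.Quotient.mk_add]
      congr 1
      apply Subtype.ext
      rw [permA, Submodule.coe_add, Submodule.coe_add, permB]
      ext i
      simp only [Pi.add_apply]
      fin_cases i <;> simp [one_add_one_eq_two, h2]
    BY := by
      rw [rep_mk]
      congr 1
      apply Subtype.ext
      rw [permB]
      ext i
      fin_cases i <;> simp
    αA := by
      intro v
      induction v using Submodule.Quotient.induction_on with | _ v =>
      have := mem_U_sum k v
      simp only [rep_mk, func_mk, permA, permB]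
      simp
      grind
    αB := by
      intro v
      induction v using Submodule.Quotient.induction_on with | _ v =>
      simp only [rep_mk, func_mk, permA, permB]
      simp
      ring
    βA := by
      intro v
      induction v using Submodule.Quotient.induction_on with | _ v =>
      simp only [rep_mk, func_mk, permA, permB]
      simp
      ring
    βB := by
      intro v
      induction v using Submodule.Quotient.induction_on with | _ v =>
      have := mem_U_sum k v
      simp only [rep_mk, func_mk, permA, permB]
      simp
      grind
    γA := by
      intro v
      induction v using Submodule.Quotient.induction_on with | _ v =>
      simp only [rep_mk, func_mk, permA, permB]
      simp
      grind
    γB := by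
      intro v
      induction v using Submodule.Quotient.induction_on with | _ v =>
      simp only [rep_mk, func_mk, permA, permB]
      simp
      grind
    αX := by simp [func_mk]
    αY := by simp [func_mk]
    βX := by simp [func_mk]
    βY := by simp [func_mk] }

end alt8

end Alt8Aux

/-- In characteristic `2`, the `6`-dimensional module `U/W` for `Alt(8)` (the natural module
for `Ω_6^+(2)`) is non-algebraic. -/
theorem alt8_natural_module_nonalgebraic (k : Type) [Field k] (hk : CharP k 2) :
    Module.finrank k (UmodW k 8) = 6 ∧ ¬ IsAlgebraic (FDRep.of (altQuotRep k 8)) :=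
  ⟨Alt8Aux.finrank_UmodW k, Alt8Aux.not_algebraic (FDRep.of (altQuotRep k 8)) Alt8Aux.pa
    Alt8Aux.pb Alt8Aux.pab Alt8Aux.pbb (Alt8Aux.data8 k)⟩
end
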